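/- Fix r₀ ∈ (0,1) and let μ be the uniform probability measure on the parameter set 𝒬̃ = {(a,f,b,c,d,e,g) ∈ [0,1]² × ℂ⁵ : Q(a,f,b,c,d,e,g) is positive semidefinite} ⊂ ℝ¹². Then the pushforward of μ under the map sending (a,f,b,c,d,e,g) to the Euclidean norm of the vector (Re(b+g) + r₀·Re(b−g), −Im(b+g) + r₀·Im(g−b), a + f − 1 + r₀(a−f)) — the Bloch radius of the image of the state with Bloch vector (0,0,r₀) — is the measure on ℝ with Lebesgue density κ(r, r₀) given by: κ(r,r₀) = (40r²/(r₀(1+r₀)⁶))·(21r⁴ − 6r²r₀² − 36r²r₀ + r₀⁴ + 6r₀³ + 12r₀² + 2r₀) for 0 < r ≤ r₀, and κ(r,r₀) = (40r(1−r)⁶/(1−r₀²)⁶)·(21r₀⁴ − 6r²r₀² − 36rr₀² + r⁴ + 6r³ + 12r² + 2r) for r₀ < r ≤ 1 (and 0 for r > 1). -/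

import Mathlib

open MeasureTheory Matrix Real ComplexOrder

/-- The Choi matrix of a general qubit channel with parameters `(a,f,b,c,d,e,g)`. -/
noncomputable def choiMat (a f : ℝ) (b c d e g : ℂ) : Matrix (Fin 4) (Fin 4) ℂ :=
  !![(a : ℂ), b, c, d;
     star b, 1 - (a : ℂ), e, -c;
     star c, star e, (f : ℂ), g;
     star d, -star c, star g, 1 - (f : ℂ)]

/-- The parameter set of general qubit channels, a Borel subset of `ℝ¹²`. -/
def qubitChannelSet : Set (ℝ × ℝ × ℂ × ℂ × ℂ × ℂ × ℂ) :=
  {p | p.1 ∈ Set.Icc (0 : ℝ) 1 ∧ p.2.1 ∈ Set.Icc (0 : ℝ) 1 ∧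
    (choiMat p.1 p.2.1 p.2.2.1 p.2.2.2.1 p.2.2.2.2.1 p.2.2.2.2.2.1
      p.2.2.2.2.2.2).PosSemidef}

/-- The uniform probability measure on the set of qubit channels. -/
noncomputable def uniformQubitChannel : Measure (ℝ × ℝ × ℂ × ℂ × ℂ × ℂ × ℂ) :=
  (volume qubitChannelSet)⁻¹ • volume.restrict qubitChannelSet

/-- The polynomial describing `fiberVol a f` where `1 ≤ a + f`. -/
noncomputable def fiberPoly (a f : ℝ) : ℝ :=
  ((1 - a) * (1 - f)) ^ 5 / 5 + (a + f - 1) * ((1 - a) * (1 - f)) ^ 4 / 2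
    + (a + f - 1) ^ 2 * ((1 - a) * (1 - f)) ^ 3 / 3

/-- The primitive of `x ↦ fiberPoly (1 - u + k * x) (1 - x)` vanishing at `0`. -/
noncomputable def fiberAntideriv (u k x : ℝ) : ℝ :=
  (u^3 / 3 - 2 / 3 * u^4 + u^5 / 3) * x^4 / 4
  + (-u^2*k - 2/3*u^3 + 8/3*u^3*k + 7/6*u^4 - 5/3*u^4*k - u^5/2) * x^5 / 5
  + (u*k^2 + 2*u^2*k - 4*u^2*k^2 + u^3/3 - 14/3*u^3*k + 10/3*u^3*k^2 - u^4/2 + 5/2*u^4*k + u^5/5)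
    * x^6 / 6
  + (-k^3/3 - 2*u*k^2 + 8/3*u*k^3 - u^2*k + 7*u^2*k^2 - 10/3*u^2*k^3 + 2*u^3*k - 5*u^3*k^2 - u^4*k)
    * x^7 / 7
  + (2/3*k^3 - 2/3*k^4 + u*k^2 - 14/3*u*k^3 + 5/3*u*k^4 - 3*u^2*k^2 + 5*u^2*k^3 + 2*u^3*k^2)
    * x^8 / 8
  + (-k^3/3 + 7/6*k^4 - k^5/3 + 2*u*k^3 - 5/2*u*k^4 - 2*u^2*k^3) * x^9 / 9
  + (-k^4/2 + k^5/2 + u*k^4) * x^10 / 10 - k^5 * x^11 / 55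

lemma hasDerivAt_fiberAntideriv (u k x : ℝ) :
    HasDerivAt (fiberAntideriv u k) (fiberPoly (1 - u + k * x) (1 - x)) x := by
  have h (n : ℕ) (c d : ℝ) : HasDerivAt (fun x : ℝ => c * x ^ (n+1) / d)
      (c * ((n+1 : ℕ) * x ^ n) / d) x := by
    simpa using ((hasDerivAt_pow (n+1) x).const_mul c).div_const d
  unfold fiberAntideriv
  refine ((((((((h 3 _ 4).add (h 4 _ 5)).add (h 5 _ 6)).add (h 6 _ 7)).add (h 7 _ 8)).add
    (h 8 _ 9)).add (h 9 _ 10)).sub (h 10 _ 55)).congr_deriv ?_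
  unfold fiberPoly
  push_cast
  ring

lemma integral_fiberPoly (u k s : ℝ) :
    ∫ x in (0 : ℝ)..s, fiberPoly (1 - u + k * x) (1 - x) = fiberAntideriv u k s := by
  rw [intervalIntegral.integral_eq_sub_of_hasDerivAt
    (fun x _ => hasDerivAt_fiberAntideriv u k x)]
  · simp [fiberAntideriv]
  · apply Continuous.intervalIntegrable
    unfold fiberPoly
    fun_prop

/-- Integral of `fiberVol` over the segment of height `z` in the unit square, for `0 ≤ z ≤ r₀`. -/
noncomputable def innerHeight (r₀ z : ℝ) : ℝ :=
  fiberAntideriv ((1 - z) / (1 + r₀)) ((1 - r₀) / (1 + r₀)) 1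
    - (r₀ - z) ^ 6 / (360 * r₀ * (1 + r₀) ^ 5)

/-- Integral of `fiberVol` over the segment of height `z` in the unit square, for `r₀ ≤ z ≤ 1`. -/
noncomputable def outerHeight (r₀ z : ℝ) : ℝ :=
  fiberAntideriv ((1 - z) / (1 + r₀)) ((1 - r₀) / (1 + r₀)) ((1 - z) / (1 - r₀))

/-- The density of the Bloch radius on `(0, r₀]`. -/
noncomputable def innerDensity (r₀ r : ℝ) : ℝ :=
  (40 * r ^ 2 / (r₀ * (1 + r₀) ^ 6))
              * (21 * r ^ 4 - 6 * r ^ 2 * r₀ ^ 2 - 36 * r ^ 2 * r₀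
                + r₀ ^ 4 + 6 * r₀ ^ 3 + 12 * r₀ ^ 2 + 2 * r₀)

/-- The density of the Bloch radius on `(r₀, 1]`. -/
noncomputable def outerDensity (r₀ r : ℝ) : ℝ :=
  (40 * r * (1 - r) ^ 6 / (1 - r₀ ^ 2) ^ 6)
              * (21 * r₀ ^ 4 - 6 * r ^ 2 * r₀ ^ 2 - 36 * r * r₀ ^ 2
                + r ^ 4 + 6 * r ^ 3 + 12 * r ^ 2 + 2 * r)

lemma hasDerivAt_fiberAntideriv_one (u k : ℝ) :
    HasDerivAt (fun u => fiberAntideriv u k 1)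
      (k^2 / 168 + 5 / 252 * k^3 + 11 / 360 * k^4
        + (-k / 105 - k^2 / 24 - 37 / 504 * k^3) * (2 * u)
        + (1 / 180 + 13 / 315 * k + 23 / 252 * k^2) * (3 * u^2)
        + (-1 / 60 - 5 / 84 * k) * (4 * u^3) + 1 / 60 * (5 * u^4)) u := by
  have h (n : ℕ) (c : ℝ) : HasDerivAt (fun x : ℝ => c * x ^ (n+1)) (c * ((n+1 : ℕ) * u ^ n)) u := by
    simpa using (hasDerivAt_pow (n+1) u).const_mul c
  have key : (fun u => fiberAntideriv u k 1) = fun u =>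
      (-k^3 / 756 - k^4 / 270 - 31 / 5940 * k^5)
        + (k^2 / 168 + 5 / 252 * k^3 + 11 / 360 * k^4) * u ^ (0 + 1)
        + (-k / 105 - k^2 / 24 - 37 / 504 * k^3) * u ^ (1 + 1)
        + (1 / 180 + 13 / 315 * k + 23 / 252 * k^2) * u ^ (2 + 1)
        + (-1 / 60 - 5 / 84 * k) * u ^ (3 + 1) + 1 / 60 * u ^ (4 + 1) := by
    funext u
    unfold fiberAntideriv
    ring
  rw [key]
  refine ((((((h 0 _).const_add _).add (h 1 _)).add (h 2 _)).add (h 3 _)).add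
    (h 4 _)).congr_deriv ?_
  push_cast
  ring

lemma hasDerivAt_innerHeight {r₀ : ℝ} (h0 : 0 < r₀) (z : ℝ) :
    ∃ d, HasDerivAt (innerHeight r₀) d z ∧ z * d = -((1 + r₀) / 50400 * innerDensity r₀ z) := by
  have hv0 : 1 + r₀ ≠ 0 := by positivity
  have h1 : HasDerivAt (fun z => (1 - z) / (1 + r₀)) (-1 / (1 + r₀)) z :=
    ((hasDerivAt_id z).const_sub 1).div_const _
  have h2 : HasDerivAt (fun z => (r₀ - z) ^ 6 / (360 * r₀ * (1 + r₀) ^ 5))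
      ((6 : ℕ) * (r₀ - z) ^ 5 * (-1) / (360 * r₀ * (1 + r₀) ^ 5)) z :=
    (((hasDerivAt_id z).const_sub r₀).pow 6).div_const _
  refine ⟨_, ((hasDerivAt_fiberAntideriv_one _ _).comp z h1).sub h2, ?_⟩
  unfold innerDensity
  field_simp
  ring

lemma outerHeight_eq {r₀ : ℝ} (h0 : 1 + r₀ ≠ 0) (h1 : 1 - r₀ ≠ 0) (z : ℝ) :
    outerHeight r₀ z = (1 / ((1 + r₀)^3 * (1 - r₀)^4 * 420)) * (1 - z) ^ (6 + 1)
      + (- (2 / ((1 + r₀)^4 * (1 - r₀)^5 * 420))) * (1 - z) ^ (7 + 1)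
      + (1 / ((1 + r₀)^5 * (1 - r₀)^4 * 1512) + 1 / ((1 + r₀)^4 * (1 - r₀)^5 * 540)
          + 1 / ((1 + r₀)^3 * (1 - r₀)^6 * 1512)) * (1 - z) ^ (8 + 1)
      + (- (2 / ((1 + r₀)^5 * (1 - r₀)^6 * 2520))) * (1 - z) ^ (9 + 1)
      + (1 / ((1 + r₀)^5 * (1 - r₀)^6 * 13860)) * (1 - z) ^ (10 + 1) := by
  unfold outerHeight fiberAntideriv
  generalize 1 - z = s
  field_simp
  ring

lemma hasDerivAt_outerHeight {r₀ : ℝ} (h0 : r₀ ∈ Set.Ioo (0 : ℝ) 1) (z : ℝ) :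
    ∃ d, HasDerivAt (outerHeight r₀) d z ∧ z * d = -((1 + r₀) / 50400 * outerDensity r₀ z) := by
  have hv0 : 1 + r₀ ≠ 0 := by linarith [h0.1]
  have hv1 : 1 - r₀ ≠ 0 := by linarith [h0.2]
  have h (n : ℕ) (c : ℝ) : HasDerivAt (fun x : ℝ => c * (1 - x) ^ (n+1))
      (c * ((n+1 : ℕ) * (1 - z) ^ n * (-1))) z := by
    simpa using (((hasDerivAt_id z).const_sub 1).pow (n+1)).const_mul c
  rw [funext (outerHeight_eq hv0 hv1)]
  refine ⟨_, ((((h 6 _).add (h 7 _)).add (h 8 _)).add (h 9 _)).add (h 10 _), ?_⟩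
  unfold outerDensity
  rw [show 1 - r₀ ^ 2 = (1 + r₀) * (1 - r₀) by ring]
  push_cast
  field_simp
  ring

lemma innerHeight_self {r₀ : ℝ} (h0 : r₀ ∈ Set.Ioo (0 : ℝ) 1) :
    innerHeight r₀ r₀ = outerHeight r₀ r₀ := by
  have hv1 : 1 - r₀ ≠ 0 := by linarith [h0.2]
  simp [innerHeight, outerHeight, div_self hv1]

lemma outerHeight_one (r₀ : ℝ) : outerHeight r₀ 1 = 0 := by
  simp [outerHeight, fiberAntideriv]

lemma integral_density {r₀ : ℝ} (h0 : r₀ ∈ Set.Ioo (0 : ℝ) 1) :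
    (∫ r in (0 : ℝ)..r₀, innerDensity r₀ r) + ∫ r in r₀..1, outerDensity r₀ r = 1 := by
  have hv0 : 1 + r₀ ≠ 0 := by linarith [h0.1]
  have hv1 : 1 - r₀ ≠ 0 := by linarith [h0.2]
  have hr : r₀ ≠ 0 := h0.1.ne'
  have h (n : ℕ) (c d z : ℝ) : HasDerivAt (fun x : ℝ => c * x ^ (n+1) / d)
      (c * ((n+1 : ℕ) * z ^ n) / d) z := by
    simpa using ((hasDerivAt_pow (n+1) z).const_mul c).div_const d
  have h' (n : ℕ) (c d z : ℝ) : HasDerivAt (fun x : ℝ => c * (1 - x) ^ (n+1) / d)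
      (c * ((n+1 : ℕ) * (1 - z) ^ n * (-1)) / d) z := by
    simpa using ((((hasDerivAt_id z).const_sub 1).pow (n+1)).const_mul c).div_const d
  have e1 : ∀ z, HasDerivAt (fun z => (40 / (r₀ * (1 + r₀) ^ 6)) * (21 * z ^ (6 + 1) / 7 +
      (- 6 * r₀ ^ 2 - 36 * r₀) * z ^ (4 + 1) / 5 +
      (r₀ ^ 4 + 6 * r₀ ^ 3 + 12 * r₀ ^ 2 + 2 * r₀) * z ^ (2 + 1) / 3)) (innerDensity r₀ z) z := by
    intro z
    refine ((((h 6 _ _ z).add (h 4 _ _ z)).add (h 2 _ _ z)).const_mul _).congr_deriv ?_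
    unfold innerDensity
    push_cast
    field_simp
    ring
  have e2 : ∀ z, HasDerivAt (fun z => (-40 / (1 - r₀ ^ 2) ^ 6) * (
      (21 * r₀ ^ 4 - 42 * r₀ ^ 2 + 21) * (1 - z) ^ (6 + 1) / 7 +
      (-21 * r₀ ^ 4 + 90 * r₀ ^ 2 - 69) * (1 - z) ^ (7 + 1) / 8 +
      (-54 * r₀ ^ 2 + 84) * (1 - z) ^ (8 + 1) / 9 + (6 * r₀ ^ 2 - 46) * (1 - z) ^ (9 + 1) / 10 +
      11 * (1 - z) ^ (10 + 1) / 11 + -1 * (1 - z) ^ (11 + 1) / 12)) (outerDensity r₀ z) z := by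
    intro z
    refine (((((((h' 6 _ _ z).add (h' 7 _ _ z)).add (h' 8 _ _ z)).add (h' 9 _ _ z)).add
      (h' 10 _ _ z)).add (h' 11 _ _ z)).const_mul _).congr_deriv ?_
    unfold outerDensity
    push_cast
    ring
  rw [intervalIntegral.integral_eq_sub_of_hasDerivAt (fun z _ => e1 z),
    intervalIntegral.integral_eq_sub_of_hasDerivAt (fun z _ => e2 z)]
  · rw [show 1 - r₀ ^ 2 = (1 + r₀) * (1 - r₀) by ring]
    field_simp
    ring
  · apply Continuous.intervalIntegrable
    unfold outerDensity
    fun_prop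
  · apply Continuous.intervalIntegrable
    unfold innerDensity
    fun_prop

lemma integral_pow_mul_height {r₀ : ℝ} (h0 : r₀ ∈ Set.Ioo (0 : ℝ) 1) (k : ℕ) :
    (2 * k + 1) * ((∫ z in (0 : ℝ)..r₀, z ^ (2 * k) * innerHeight r₀ z)
        + ∫ z in r₀..1, z ^ (2 * k) * outerHeight r₀ z) =
      (1 + r₀) / 50400 * ((∫ r in (0 : ℝ)..r₀, r ^ (2 * k) * innerDensity r₀ r)
        + ∫ r in r₀..1, r ^ (2 * k) * outerDensity r₀ r) := by
  have hp (z : ℝ) : HasDerivAt (fun z : ℝ => z ^ (2 * k + 1)) ((2 * k + 1) * z ^ (2 * k)) z := by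
    simpa using hasDerivAt_pow (2 * k + 1) z
  have aux (g ρ : ℝ → ℝ) (hg : ∀ z, ∃ d, HasDerivAt g d z ∧ z * d = -((1 + r₀) / 50400 * ρ z))
      (hρ : Continuous ρ) (a b : ℝ) :
      (2 * k + 1) * (∫ z in a..b, z ^ (2 * k) * g z)
        - (1 + r₀) / 50400 * (∫ r in a..b, r ^ (2 * k) * ρ r)
        = b ^ (2 * k + 1) * g b - a ^ (2 * k + 1) * g a := by
    have hgc : Continuous g :=
      continuous_iff_continuousAt.2 fun z => (hg z).choose_spec.1.continuousAt
    have i1 : IntervalIntegrable (fun z => (2 * k + 1) * (z ^ (2 * k) * g z)) volume a b := by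
      apply Continuous.intervalIntegrable
      fun_prop
    have i2 : IntervalIntegrable (fun z => (1 + r₀) / 50400 * (z ^ (2 * k) * ρ z)) volume a b := by
      apply Continuous.intervalIntegrable
      fun_prop
    rw [← intervalIntegral.integral_const_mul, ← intervalIntegral.integral_const_mul,
      ← intervalIntegral.integral_sub i1 i2]
    apply intervalIntegral.integral_eq_sub_of_hasDerivAt (f := fun z => z ^ (2 * k + 1) * g z)
    · intro z _
      obtain ⟨d, hd, hz⟩ := hg z
      refine ((hp z).mul hd).congr_deriv ?_
      rw [pow_succ]
      linear_combination z ^ (2 * k) * hz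
    · exact i1.sub i2
  have A := aux (innerHeight r₀) (innerDensity r₀) (hasDerivAt_innerHeight h0.1)
    (by unfold innerDensity; fun_prop) 0 r₀
  have B := aux (outerHeight r₀) (outerDensity r₀) (hasDerivAt_outerHeight h0)
    (by unfold outerDensity; fun_prop) r₀ 1
  rw [innerHeight_self h0] at A
  rw [outerHeight_one] at B
  simp only [ne_eq, Nat.add_eq_zero_iff, one_ne_zero, and_false, not_false_eq_true, zero_pow,
    zero_mul, mul_zero] at A B
  linear_combination A + B
/-- The volume, up to a constant, of the set of channels with diagonal parameters `a` and `f`. -/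
noncomputable def fiberVol (a f : ℝ) : ℝ := fiberPoly a f - max (1 - a - f) 0 ^ 5 / 30

lemma integral_sq_mul_sq (X Y s : ℝ) : ∫ u in (0 : ℝ)..s, (X - u) ^ 2 * (Y - u) ^ 2 =
    X ^ 2 * Y ^ 2 * s - X * Y * (X + Y) * s ^ 2 + (X ^ 2 + 4 * X * Y + Y ^ 2) * s ^ 3 / 3
      - (X + Y) * s ^ 4 / 2 + s ^ 5 / 5 := by
  rw [intervalIntegral.integral_eq_sub_of_hasDerivAt
    (f := fun s => X ^ 2 * Y ^ 2 * s - X * Y * (X + Y) * s ^ 2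
      + (X ^ 2 + 4 * X * Y + Y ^ 2) * s ^ 3 / 3 - (X + Y) * s ^ 4 / 2 + s ^ 5 / 5)]
  · simp
  · intro x _
    refine (((((hasDerivAt_id x).const_mul _).sub ((hasDerivAt_pow 2 x).const_mul _)).add
      (((hasDerivAt_pow 3 x).const_mul _).div_const _)).sub
      (((hasDerivAt_pow 4 x).const_mul _).div_const _)).add
      ((hasDerivAt_pow 5 x).div_const _) |>.congr_deriv ?_
    push_cast
    ring
  · apply Continuous.intervalIntegrable
    fun_prop

lemma integral_eq_fiberVol (a f : ℝ) :
    ∫ u in (0 : ℝ)..min (a * f) ((1 - a) * (1 - f)),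
      (a * f - u) ^ 2 * ((1 - a) * (1 - f) - u) ^ 2 = fiberVol a f := by
  rw [integral_sq_mul_sq]
  unfold fiberVol fiberPoly
  rcases le_total (1 - a - f) 0 with h | h
  · rw [min_eq_right (by linarith), max_eq_right h]
    ring
  · rw [min_eq_left (by linarith), max_eq_left h]
    ring

lemma fiberVol_nonneg {a f : ℝ} (ha : a ∈ Set.Icc (0 : ℝ) 1) (hf : f ∈ Set.Icc (0 : ℝ) 1) :
    0 ≤ fiberVol a f := by
  rw [← integral_eq_fiberVol]
  apply intervalIntegral.integral_nonneg
  · exact le_min (mul_nonneg ha.1 hf.1)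
      (mul_nonneg (by linarith [ha.2]) (by linarith [hf.2]))
  · intro u _
    positivity

lemma fiberVol_symm (a f : ℝ) : fiberVol (1 - a) (1 - f) = fiberVol a f := by
  rw [← integral_eq_fiberVol, ← integral_eq_fiberVol, min_comm]
  simp only [sub_sub_cancel]
  simp_rw [mul_comm]

lemma continuous_fiberVol : Continuous (fun p : ℝ × ℝ => fiberVol p.1 p.2) := by
  unfold fiberVol fiberPoly
  fun_prop

lemma integral_max_pow (α β s : ℝ) (hβ : 0 < β) (hα : α ≤ 0) (hs : 0 ≤ α + β * s) :
    ∫ x in (0 : ℝ)..s, max (α + β * x) 0 ^ 5 = (α + β * s) ^ 6 / (6 * β) := by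
  have hx : 0 ≤ -α / β := div_nonneg (by linarith) hβ.le
  have hx' : -α / β ≤ s := by rw [div_le_iff₀ hβ]; linarith
  have hc : Continuous fun x => max (α + β * x) 0 ^ 5 := by fun_prop
  rw [← intervalIntegral.integral_add_adjacent_intervals (b := -α / β)
    (hc.intervalIntegrable _ _) (hc.intervalIntegrable _ _)]
  have e1 : ∫ x in (0 : ℝ)..(-α / β), max (α + β * x) 0 ^ 5 = 0 := by
    rw [intervalIntegral.integral_congr (g := fun _ => 0)]
    · simp
    · intro x hx2
      rw [Set.uIcc_of_le hx] at hx2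
      have := (le_div_iff₀ hβ).1 hx2.2
      simp only
      rw [max_eq_right (by linarith)]
      simp
  have e2 : ∫ x in (-α / β)..s, max (α + β * x) 0 ^ 5 = ∫ x in (-α / β)..s, (α + β * x) ^ 5 := by
    apply intervalIntegral.integral_congr
    intro x hx2
    rw [Set.uIcc_of_le hx'] at hx2
    have := (div_le_iff₀ hβ).1 hx2.1
    simp only
    rw [max_eq_left (by linarith)]
  rw [e1, e2, intervalIntegral.integral_eq_sub_of_hasDerivAt
    (f := fun x => (α + β * x) ^ 6 / (6 * β))]
  · field_simp
    ring
  · intro x _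
    refine (((((hasDerivAt_id x).const_mul β).const_add α).pow 6).div_const (6 * β)).congr_deriv ?_
    push_cast
    field_simp
    simp
  · apply Continuous.intervalIntegrable
    fun_prop

lemma integral_fiberVol_inner {r₀ z : ℝ} (h0 : 0 < r₀) (hz0 : 0 ≤ z) (hz : z ≤ r₀) :
    ∫ x in (0 : ℝ)..1, fiberVol ((z + 1 - (1 - r₀) * (1 - x)) / (1 + r₀)) (1 - x)
      = innerHeight r₀ z := by
  have h1 : 1 + r₀ ≠ 0 := by positivity
  have e (x : ℝ) : fiberVol ((z + 1 - (1 - r₀) * (1 - x)) / (1 + r₀)) (1 - x) =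
      fiberPoly (1 - (1 - z) / (1 + r₀) + (1 - r₀) / (1 + r₀) * x) (1 - x)
      - max (-(r₀ + z) / (1 + r₀) + 2 * r₀ / (1 + r₀) * x) 0 ^ 5 / 30 := by
    have e1 : (z + 1 - (1 - r₀) * (1 - x)) / (1 + r₀) =
      1 - (1 - z) / (1 + r₀) + (1 - r₀) / (1 + r₀) * x := by field_simp; ring
    have e2 : 1 - (1 - (1 - z) / (1 + r₀) + (1 - r₀) / (1 + r₀) * x) - (1 - x) =
      -(r₀ + z) / (1 + r₀) + 2 * r₀ / (1 + r₀) * x := by field_simp; ring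
    rw [e1, fiberVol, e2]
  simp_rw [e]
  rw [intervalIntegral.integral_sub, integral_fiberPoly, intervalIntegral.integral_div,
    integral_max_pow]
  · unfold innerHeight
    rw [show -(r₀ + z) / (1 + r₀) + 2 * r₀ / (1 + r₀) * 1 = (r₀ - z) / (1 + r₀) by
      field_simp; ring]
    congr 1
    field_simp
    ring
  · positivity
  · rw [neg_div]
    have : 0 ≤ (r₀ + z) / (1 + r₀) := by positivity
    linarith
  · rw [show -(r₀ + z) / (1 + r₀) + 2 * r₀ / (1 + r₀) * 1 = (r₀ - z) / (1 + r₀) by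
      field_simp; ring]
    exact div_nonneg (by linarith) (by linarith)
  · apply Continuous.intervalIntegrable
    unfold fiberPoly
    fun_prop
  · apply Continuous.intervalIntegrable
    fun_prop

lemma integral_fiberVol_outer {r₀ z : ℝ} (h0 : r₀ ∈ Set.Ioo (0 : ℝ) 1) (hz : r₀ ≤ z) (hz1 : z ≤ 1) :
    ∫ x in (0 : ℝ)..(1 - z) / (1 - r₀),
        fiberVol ((z + 1 - (1 - r₀) * (1 - x)) / (1 + r₀)) (1 - x)
      = outerHeight r₀ z := by
  have h1 : 0 < 1 + r₀ := by linarith [h0.1]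
  have h2 : 0 < 1 - r₀ := by linarith [h0.2]
  have hs : 0 ≤ (1 - z) / (1 - r₀) := div_nonneg (by linarith) h2.le
  rw [outerHeight, ← integral_fiberPoly]
  apply intervalIntegral.integral_congr
  intro x hx
  rw [Set.uIcc_of_le hs] at hx
  have hx1 : x ≤ 1 := hx.2.trans (by rw [div_le_one h2]; linarith)
  have e1 : (z + 1 - (1 - r₀) * (1 - x)) / (1 + r₀) =
      1 - (1 - z) / (1 + r₀) + (1 - r₀) / (1 + r₀) * x := by field_simp; ring
  have e2 : 1 - (1 - (1 - z) / (1 + r₀) + (1 - r₀) / (1 + r₀) * x) - (1 - x) =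
      -(r₀ + z - 2 * r₀ * x) / (1 + r₀) := by field_simp; ring
  simp only
  rw [e1, fiberVol, e2, max_eq_right]
  · simp
  · apply div_nonpos_of_nonpos_of_nonneg _ h1.le
    nlinarith [h0.1]
open Set in
lemma lintegral_comp_smul_add {E : Type*} [NormedAddCommGroup E] [NormedSpace ℝ E]
    [MeasurableSpace E] [BorelSpace E] [FiniteDimensional ℝ E] (μ : Measure E)
    [μ.IsAddHaarMeasure] {r : ℝ} (hr : r ≠ 0) (t : E) (F : E → ENNReal) :
    ∫⁻ x, F (r • x + t) ∂μ = ENNReal.ofReal |(r ^ Module.finrank ℝ E)⁻¹| * ∫⁻ x, F x ∂μ := by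
  have h1 := (measurableEmbedding_const_smul₀ hr).lintegral_map (μ := μ) (fun x => F (x + t))
  rw [Measure.map_addHaar_smul μ hr, lintegral_smul_measure] at h1
  rw [← h1, lintegral_add_right_eq_self F t, smul_eq_mul]

/-- The volume of the fibre, as an extended nonnegative function on the open square. -/
noncomputable def squareDensity (a f : ℝ) : ENNReal :=
  (Set.Ioo (0 : ℝ) 1 ×ˢ Set.Ioo (0 : ℝ) 1).indicator
    (fun p => ENNReal.ofReal (fiberVol p.1 p.2)) (a, f)

lemma measurable_squareDensity : Measurable (fun p : ℝ × ℝ => squareDensity p.1 p.2) :=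
  (ENNReal.measurable_ofReal.comp continuous_fiberVol.measurable).indicator
    (measurableSet_Ioo.prod measurableSet_Ioo)

lemma squareDensity_symm (a f : ℝ) : squareDensity (1 - a) (1 - f) = squareDensity a f := by
  simp only [squareDensity, Set.indicator, Set.mem_prod, Set.mem_Ioo, fiberVol_symm]
  congr 1
  simp only [sub_pos, sub_lt_self_iff, eq_iff_iff]
  tauto

/-- The density, up to a constant, of the third Bloch coordinate `a + f - 1 + r₀ (a - f)`. -/
noncomputable def heightDensity (r₀ z : ℝ) : ENNReal :=
  ∫⁻ x, squareDensity ((z + 1 - (1 - r₀) * (1 - x)) / (1 + r₀)) (1 - x)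

lemma heightDensity_neg {r₀ : ℝ} (h0 : 0 < r₀) (z : ℝ) :
    heightDensity r₀ (-z) = heightDensity r₀ z := by
  have h1 : 1 + r₀ ≠ 0 := by positivity
  unfold heightDensity
  rw [← lintegral_sub_left_eq_self _ (1 : ℝ)]
  apply lintegral_congr
  intro x
  rw [← squareDensity_symm]
  congr 1
  · field_simp
    ring
  · ring

lemma heightDensity_eq {r₀ z : ℝ} (h0 : r₀ ∈ Set.Ioo (0 : ℝ) 1) (hz : 0 < z) :
    heightDensity r₀ z = if z ≤ r₀ then ENNReal.ofReal (innerHeight r₀ z) else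
      if z ≤ 1 then ENNReal.ofReal (outerHeight r₀ z) else 0 := by
  have h1 : 0 < 1 + r₀ := by linarith [h0.1]
  have h2 : 0 < 1 - r₀ := by linarith [h0.2]
  have hmem (x : ℝ) : ((z + 1 - (1 - r₀) * (1 - x)) / (1 + r₀), 1 - x) ∈
      Set.Ioo (0 : ℝ) 1 ×ˢ Set.Ioo (0 : ℝ) 1 ↔ x ∈ Set.Ioo 0 (min 1 ((1 - z) / (1 - r₀))) := by
    simp only [Set.mem_prod, Set.mem_Ioo, lt_min_iff, lt_div_iff₀ h2, div_lt_one h1, div_pos_iff]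
    constructor
    · rintro ⟨⟨_, h⟩, h', h''⟩
      refine ⟨by linarith, by linarith, by linarith⟩
    · rintro ⟨h, h', h''⟩
      refine ⟨⟨Or.inl ⟨by nlinarith [mul_pos h2 h, h0.1], h1⟩, by linarith⟩, by linarith,
        by linarith⟩
  have key (s : ℝ) (hs : 0 ≤ s) (hs1 : min 1 ((1 - z) / (1 - r₀)) = s) : heightDensity r₀ z =
      ENNReal.ofReal (∫ x in (0 : ℝ)..s,
        fiberVol ((z + 1 - (1 - r₀) * (1 - x)) / (1 + r₀)) (1 - x)) := by
    rw [intervalIntegral.integral_of_le hs, integral_Ioc_eq_integral_Ioo,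
      ofReal_integral_eq_lintegral_ofReal, ← lintegral_indicator measurableSet_Ioo]
    · apply lintegral_congr
      intro x
      simp only [squareDensity, Set.indicator, hmem, hs1]
    · apply IntegrableOn.mono_set _ Set.Ioo_subset_Icc_self
      apply Continuous.integrableOn_Icc
      exact continuous_fiberVol.comp
        (f := fun x : ℝ => ((z + 1 - (1 - r₀) * (1 - x)) / (1 + r₀), 1 - x)) (by fun_prop)
    · filter_upwards [ae_restrict_mem measurableSet_Ioo] with x hx
      rw [← hs1, ← hmem] at hx
      exact fiberVol_nonneg (Set.Ioo_subset_Icc_self hx.1) (Set.Ioo_subset_Icc_self hx.2)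
  split_ifs with h3 h4
  · rw [key 1 zero_le_one, integral_fiberVol_inner h0.1 hz.le h3]
    rw [min_eq_left]
    rw [one_le_div h2]
    linarith
  · rw [key ((1 - z) / (1 - r₀)), integral_fiberVol_outer h0 (le_of_not_ge h3) h4]
    · exact div_nonneg (by linarith) h2.le
    · rw [min_eq_right]
      rw [div_le_one h2]
      linarith
  · rw [heightDensity, lintegral_eq_zero_iff']
    · filter_upwards with x
      simp only [squareDensity, Pi.zero_apply, Set.indicator_apply_eq_zero, hmem]
      intro hx
      have : x < (1 - z) / (1 - r₀) := hx.2.trans_le (min_le_right _ _)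
      rw [lt_div_iff₀ h2] at this
      nlinarith [hx.1]
    · apply Measurable.aemeasurable
      exact measurable_squareDensity.comp
        (f := fun x : ℝ => ((z + 1 - (1 - r₀) * (1 - x)) / (1 + r₀), 1 - x)) (by fun_prop)

lemma lintegral_pow_mul_squareDensity {r₀ : ℝ} (h0 : 0 < r₀) (k : ℕ) :
    ∫⁻ a, ∫⁻ f, ENNReal.ofReal ((a + f - 1 + r₀ * (a - f)) ^ (2 * k)) * squareDensity a f =
      ENNReal.ofReal (1 + r₀)⁻¹ *
        ∫⁻ z, ENNReal.ofReal (z ^ (2 * k)) * heightDensity r₀ z := by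
  have h1 : 0 < 1 + r₀ := by linarith
  have hm : Measurable fun p : ℝ × ℝ =>
      ENNReal.ofReal ((p.1 + p.2 - 1 + r₀ * (p.1 - p.2)) ^ (2 * k)) * squareDensity p.1 p.2 :=
    Measurable.mul (by fun_prop) measurable_squareDensity
  have hm2 : Measurable fun p : ℝ × ℝ =>
      ENNReal.ofReal (p.2 ^ (2 * k)) *
        squareDensity ((p.2 + 1 - (1 - r₀) * (1 - p.1)) / (1 + r₀)) (1 - p.1) :=
    Measurable.mul (by fun_prop) (measurable_squareDensity.comp
      (f := fun p : ℝ × ℝ => ((p.2 + 1 - (1 - r₀) * (1 - p.1)) / (1 + r₀), 1 - p.1)) (by fun_prop))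
  rw [lintegral_lintegral_swap hm.aemeasurable, ← lintegral_sub_left_eq_self _ (1 : ℝ)]
  have e (x : ℝ) : ∫⁻ a, ENNReal.ofReal ((a + (1 - x) - 1 + r₀ * (a - (1 - x))) ^ (2 * k)) *
        squareDensity a (1 - x) = ENNReal.ofReal (1 + r₀)⁻¹ *
        ∫⁻ z, ENNReal.ofReal (z ^ (2 * k)) *
          squareDensity ((z + 1 - (1 - r₀) * (1 - x)) / (1 + r₀)) (1 - x) := by
    have := lintegral_comp_smul_add volume h1.ne' ((1 - r₀) * (1 - x) - 1)
      (fun z => ENNReal.ofReal (z ^ (2 * k)) *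
          squareDensity ((z + 1 - (1 - r₀) * (1 - x)) / (1 + r₀)) (1 - x))
    rw [Module.finrank_self, pow_one, abs_of_pos (inv_pos.2 h1)] at this
    rw [← this]
    apply lintegral_congr
    intro a
    simp only [smul_eq_mul]
    congr 3
    · ring
    · field_simp
      ring
  simp_rw [e]
  rw [lintegral_const_mul _ hm2.lintegral_prod_right', lintegral_lintegral_swap hm2.aemeasurable]
  congr 1
  apply lintegral_congr
  intro z
  simp only
  rw [lintegral_const_mul _, heightDensity]
  exact measurable_squareDensity.comp
        (f := fun x : ℝ => ((z + 1 - (1 - r₀) * (1 - x)) / (1 + r₀), 1 - x)) (by fun_prop)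

lemma lintegral_eq_two_mul_setLIntegral_Ioi {F : ℝ → ENNReal} (hF : ∀ z, F (-z) = F z) :
    ∫⁻ z, F z = 2 * ∫⁻ z in Set.Ioi 0, F z := by
  have h : ∫⁻ z in Set.Iic 0, F z = ∫⁻ z in Set.Ioi 0, F z := by
    have := (Measure.measurePreserving_neg (volume : Measure ℝ)).setLIntegral_comp_emb
      (MeasurableEquiv.neg ℝ).measurableEmbedding F (Set.Ici 0)
    simp only [hF, Set.image_neg_eq_neg, Set.neg_Ici, neg_zero] at this
    rw [← this]
    exact setLIntegral_congr Ioi_ae_eq_Ici.symm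
  rw [← lintegral_add_compl F (measurableSet_Ioi (a := (0 : ℝ))), Set.compl_Ioi, h, two_mul]
lemma radial_poly_nonneg {x y : ℝ} (hx : 0 ≤ x) (hxy : x ≤ y) (hy : y ≤ 1) :
    0 ≤ 21 * x ^ 4 - 6 * x ^ 2 * y ^ 2 - 36 * x ^ 2 * y + y ^ 4 + 6 * y ^ 3 + 12 * y ^ 2
      + 2 * y := by
  have h0 : 0 ≤ y := hx.trans hxy
  have h1 : 0 ≤ y ^ 2 - x ^ 2 := by nlinarith
  have h2 : 0 ≤ 36 * y * (1 - y) + 21 * (y ^ 2 - x ^ 2) := by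
    have : 0 ≤ y * (1 - y) := mul_nonneg h0 (by linarith)
    linarith
  have h3 : 0 ≤ 2 * y * (1 - y) ^ 2 * (8 * y + 1) := by positivity
  linarith [mul_nonneg h1 h2]

lemma innerDensity_nonneg {r₀ r : ℝ} (h0 : r₀ ∈ Set.Ioo (0 : ℝ) 1) (hr : 0 ≤ r) (hr' : r ≤ r₀) :
    0 ≤ innerDensity r₀ r := by
  have h1 := h0.1
  have := radial_poly_nonneg hr hr' h0.2.le
  exact mul_nonneg (by positivity) this

lemma outerDensity_nonneg {r₀ r : ℝ} (h0 : r₀ ∈ Set.Ioo (0 : ℝ) 1) (hr : r₀ ≤ r) (hr' : r ≤ 1) :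
    0 ≤ outerDensity r₀ r := by
  have h1 := h0.1
  have h2 : 0 ≤ r := h1.le.trans hr
  have := radial_poly_nonneg h1.le hr hr'
  refine mul_nonneg (by positivity) ?_
  linarith

lemma innerHeight_nonneg {r₀ z : ℝ} (h0 : r₀ ∈ Set.Ioo (0 : ℝ) 1) (hz0 : 0 ≤ z) (hz : z ≤ r₀) :
    0 ≤ innerHeight r₀ z := by
  have h1 : 0 < 1 + r₀ := by linarith [h0.1]
  have h2 : 0 < 1 - r₀ := by linarith [h0.2]
  rw [← integral_fiberVol_inner h0.1 hz0 hz]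
  refine intervalIntegral.integral_nonneg zero_le_one fun x hx => fiberVol_nonneg ⟨?_, ?_⟩ ⟨?_, ?_⟩
  · exact div_nonneg (by nlinarith [mul_nonneg h2.le hx.1, h0.1]) h1.le
  · rw [div_le_one h1]
    nlinarith [mul_nonneg h2.le (sub_nonneg.2 hx.2)]
  · linarith [hx.2]
  · linarith [hx.1]

lemma outerHeight_nonneg {r₀ z : ℝ} (h0 : r₀ ∈ Set.Ioo (0 : ℝ) 1) (hz : r₀ ≤ z) (hz1 : z ≤ 1) :
    0 ≤ outerHeight r₀ z := by
  have h1 : 0 < 1 + r₀ := by linarith [h0.1]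
  have h2 : 0 < 1 - r₀ := by linarith [h0.2]
  rw [← integral_fiberVol_outer h0 hz hz1]
  refine intervalIntegral.integral_nonneg (div_nonneg (by linarith) h2.le)
    fun x hx => fiberVol_nonneg ⟨?_, ?_⟩ ⟨?_, ?_⟩
  · exact div_nonneg (by nlinarith [mul_nonneg h2.le hx.1, h0.1]) h1.le
  · have := (le_div_iff₀ h2).1 hx.2
    rw [div_le_one h1]
    linarith
  · have := (le_div_iff₀ h2).1 hx.2
    nlinarith
  · linarith [hx.1]

lemma continuous_innerHeight {r₀ : ℝ} (h0 : 0 < r₀) : Continuous (innerHeight r₀) :=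
  continuous_iff_continuousAt.2 fun z => (hasDerivAt_innerHeight h0 z).choose_spec.1.continuousAt

lemma continuous_outerHeight {r₀ : ℝ} (h0 : r₀ ∈ Set.Ioo (0 : ℝ) 1) : Continuous (outerHeight r₀) :=
  continuous_iff_continuousAt.2 fun z => (hasDerivAt_outerHeight h0 z).choose_spec.1.continuousAt

/-- Integral over `(0, ∞)` of a weight against a piecewise continuous density on `(0, 1]`. -/
lemma setLIntegral_piecewise {r₀ : ℝ} (h0 : r₀ ∈ Set.Ioo (0 : ℝ) 1) {w p q : ℝ → ℝ}
    (hw : Continuous w) (hw0 : ∀ z, 0 ≤ w z) (hp : Continuous p) (hq : Continuous q)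
    (hp0 : ∀ z, 0 ≤ z → z ≤ r₀ → 0 ≤ p z) (hq0 : ∀ z, r₀ ≤ z → z ≤ 1 → 0 ≤ q z)
    {D : ℝ → ENNReal}
    (hD : ∀ z, 0 < z → D z = if z ≤ r₀ then ENNReal.ofReal (p z) else
      if z ≤ 1 then ENNReal.ofReal (q z) else 0) :
    ∫⁻ z in Set.Ioi 0, ENNReal.ofReal (w z) * D z =
      ENNReal.ofReal ((∫ z in (0 : ℝ)..r₀, w z * p z) + ∫ z in r₀..1, w z * q z) := by
  have aux (a b : ℝ) (hab : a ≤ b) (f : ℝ → ℝ) (hf : Continuous f)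
      (hf0 : ∀ z ∈ Set.Ioc a b, 0 ≤ f z)
      (hDf : ∀ z ∈ Set.Ioc a b, D z = ENNReal.ofReal (f z)) :
      ∫⁻ z in Set.Ioc a b, ENNReal.ofReal (w z) * D z =
        ENNReal.ofReal (∫ z in a..b, w z * f z) := by
    rw [intervalIntegral.integral_of_le hab, ofReal_integral_eq_lintegral_ofReal]
    · apply setLIntegral_congr_fun measurableSet_Ioc
      intro z hz
      simp only
      rw [hDf z hz, ENNReal.ofReal_mul (hw0 z)]
    · exact ((hw.mul hf).integrableOn_Icc).mono_set Set.Ioc_subset_Icc_self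
    · filter_upwards [ae_restrict_mem measurableSet_Ioc] with z hz
      exact mul_nonneg (hw0 z) (hf0 z hz)
  have h3 : ∫⁻ z in Set.Ioi 1, ENNReal.ofReal (w z) * D z = 0 := by
    rw [setLIntegral_congr_fun (g := fun _ => 0) measurableSet_Ioi]
    · simp
    · intro z hz
      have hz : 1 < z := hz
      simp only
      rw [hD z (by linarith), if_neg (by linarith [h0.2]), if_neg (by linarith), mul_zero]
  rw [← Set.Ioc_union_Ioi_eq_Ioi h0.1.le, lintegral_union measurableSet_Ioi
    (Set.Ioc_disjoint_Ioi le_rfl), ← Set.Ioc_union_Ioi_eq_Ioi h0.2.le,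
    lintegral_union measurableSet_Ioi (Set.Ioc_disjoint_Ioi le_rfl), h3, add_zero,
    aux 0 r₀ h0.1.le p hp, aux r₀ 1 h0.2.le q hq, ENNReal.ofReal_add]
  · exact intervalIntegral.integral_nonneg h0.1.le
      fun z hz => mul_nonneg (hw0 z) (hp0 z hz.1 hz.2)
  · exact intervalIntegral.integral_nonneg h0.2.le
      fun z hz => mul_nonneg (hw0 z) (hq0 z hz.1 hz.2)
  · exact fun z hz => hq0 z hz.1.le hz.2
  · intro z hz
    rw [hD z (h0.1.trans hz.1), if_neg (not_le.2 hz.1), if_pos hz.2]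
  · exact fun z hz => hp0 z hz.1.le hz.2
  · intro z hz
    rw [hD z hz.1, if_pos hz.2]

lemma lintegral_pow_mul_squareDensity_eq {r₀ : ℝ} (h0 : r₀ ∈ Set.Ioo (0 : ℝ) 1) (k : ℕ) :
    ∫⁻ a, ∫⁻ f, ENNReal.ofReal ((a + f - 1 + r₀ * (a - f)) ^ (2 * k)) * squareDensity a f =
      ENNReal.ofReal (1 / 25200 / (2 * k + 1) *
        ((∫ r in (0 : ℝ)..r₀, r ^ (2 * k) * innerDensity r₀ r)
        + ∫ r in r₀..1, r ^ (2 * k) * outerDensity r₀ r)) := by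
  have h1 : 0 < 1 + r₀ := by linarith [h0.1]
  have hk (z : ℝ) : 0 ≤ z ^ (2 * k) := by
    rw [pow_mul]
    positivity
  rw [lintegral_pow_mul_squareDensity h0.1, lintegral_eq_two_mul_setLIntegral_Ioi,
    setLIntegral_piecewise h0 (by fun_prop) hk (continuous_innerHeight h0.1)
      (continuous_outerHeight h0) (fun z => innerHeight_nonneg h0) (fun z => outerHeight_nonneg h0)
      (fun z => heightDensity_eq h0),
    show (2 : ENNReal) = ENNReal.ofReal 2 by simp, ← ENNReal.ofReal_mul (by norm_num),
    ← ENNReal.ofReal_mul (by positivity)]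
  · congr 1
    have := integral_pow_mul_height h0 k
    have h2 : (2 * k + 1 : ℝ) ≠ 0 := by positivity
    field_simp
    field_simp at this
    linarith
  · intro z
    rw [heightDensity_neg h0.1, pow_mul, pow_mul, neg_sq]

/-- The Choi matrix normalised to have identity diagonal blocks. -/
def contractionMat (k₁ k₂ k₃ k₄ : ℂ) : Matrix (Fin 4) (Fin 4) ℂ :=
  !![1, k₁, 0, k₂;
     star k₁, 1, k₃, 0;
     0, star k₃, 1, k₄;
     star k₂, 0, star k₄, 1]

/-- The direct sum of two lower triangular `2 × 2` matrices, in the ordering of the Choi matrix. -/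
def lowerPair (l₁ l₂ m₁ m₂ : ℝ) (l m : ℂ) : Matrix (Fin 4) (Fin 4) ℂ :=
  !![(l₁ : ℂ), 0, 0, 0;
     0, (m₁ : ℂ), 0, 0;
     l, 0, (l₂ : ℂ), 0;
     0, m, 0, (m₂ : ℂ)]

lemma isUnit_lowerPair {l₁ l₂ m₁ m₂ : ℝ} (h₁ : l₁ ≠ 0) (h₂ : l₂ ≠ 0) (h₃ : m₁ ≠ 0) (h₄ : m₂ ≠ 0)
    (l m : ℂ) : IsUnit (lowerPair l₁ l₂ m₁ m₂ l m) := by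
  rw [Matrix.isUnit_iff_isUnit_det, isUnit_iff_ne_zero]
  have : (lowerPair l₁ l₂ m₁ m₂ l m).det = l₁ * m₁ * l₂ * m₂ := by
    simp [lowerPair, Matrix.det_succ_row_zero, Fin.sum_univ_succ, Fin.succAbove]
    ring
  rw [this]
  simp [h₁, h₂, h₃, h₄]

lemma choiMat_eq_conj {a f l₁ l₂ m₁ m₂ : ℝ} {c l m : ℂ} (ha : a = l₁ ^ 2) (ha' : 1 - a = m₁ ^ 2)
    (hc : c = l₁ * star l) (hc' : -c = m₁ * star m) (hf : f = Complex.normSq l + l₂ ^ 2)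
    (hf' : 1 - f = Complex.normSq m + m₂ ^ 2) (k₁ k₂ k₃ k₄ : ℂ) :
    choiMat a f (l₁ * m₁ * k₁) c (l₁ * m₂ * k₂ + l₁ * star m * k₁)
      (m₁ * l₂ * k₃ + m₁ * star l * star k₁)
      (l₂ * m₂ * k₄ + (l₂ * star m * star k₃ + l * m₂ * k₂ + l * star m * k₁)) =
    lowerPair l₁ l₂ m₁ m₂ l m * contractionMat k₁ k₂ k₃ k₄ * star (lowerPair l₁ l₂ m₁ m₂ l m) := by
  have e1 : (a : ℂ) = l₁ ^ 2 := by rw [ha]; push_cast; ring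
  have e2 : 1 - (a : ℂ) = m₁ ^ 2 := by exact_mod_cast ha'
  have e3 : (f : ℂ) = l * star l + l₂ ^ 2 := by
    rw [hf, ← starRingEnd_apply, Complex.mul_conj]
    push_cast
    ring
  have e4 : 1 - (f : ℂ) = m * star m + m₂ ^ 2 := by
    rw [← starRingEnd_apply, Complex.mul_conj]
    exact_mod_cast hf'
  have e5 : star c = l₁ * l := by simp [hc]
  have e6 : -star c = m₁ * m := by rw [← star_neg, hc']; simp
  unfold choiMat
  rw [e2, e4, hc', e6, e1, e3, e5, hc]
  ext i j
  fin_cases i <;> fin_cases j <;>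
  simp [lowerPair, contractionMat, Matrix.mul_apply, Fin.sum_univ_four, Matrix.star_apply] <;> ring

lemma posSemidef_choiMat_iff {a f l₁ l₂ m₁ m₂ : ℝ} {c l m : ℂ} (ha : a = l₁ ^ 2)
    (ha' : 1 - a = m₁ ^ 2)
    (hc : c = l₁ * star l) (hc' : -c = m₁ * star m) (hf : f = Complex.normSq l + l₂ ^ 2)
    (hf' : 1 - f = Complex.normSq m + m₂ ^ 2) (h₁ : l₁ ≠ 0) (h₂ : l₂ ≠ 0) (h₃ : m₁ ≠ 0)
    (h₄ : m₂ ≠ 0) (k₁ k₂ k₃ k₄ : ℂ) :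
    (choiMat a f (l₁ * m₁ * k₁) c (l₁ * m₂ * k₂ + l₁ * star m * k₁)
      (m₁ * l₂ * k₃ + m₁ * star l * star k₁)
      (l₂ * m₂ * k₄ + (l₂ * star m * star k₃ + l * m₂ * k₂ + l * star m * k₁))).PosSemidef ↔
    (contractionMat k₁ k₂ k₃ k₄).PosSemidef := by
  rw [choiMat_eq_conj ha ha' hc hc' hf hf']
  exact (isUnit_lowerPair h₁ h₂ h₃ h₄ l m).posSemidef_star_right_conjugate_iff

lemma norm_sq_le_of_posSemidef {M : Matrix (Fin 4) (Fin 4) ℂ} (hM : M.PosSemidef) (i j : Fin 4)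
    {p q : ℝ} (hp : M i i = p) (hq : M j j = q) : ‖M i j‖ ^ 2 ≤ p * q := by
  have h := (hM.submatrix ![i, j]).det_nonneg
  rw [Matrix.det_fin_two] at h
  simp only [Matrix.submatrix_apply, Matrix.cons_val_zero, Matrix.cons_val_one] at h
  rw [hp, hq, ← hM.1.apply j i, ← starRingEnd_apply, Complex.mul_conj, Complex.normSq_eq_norm_sq]
    at h
  have : (0 : ℂ) ≤ ((p * q - ‖M i j‖ ^ 2 : ℝ) : ℂ) := by exact_mod_cast h
  rw [Complex.zero_le_real] at this
  linarith

lemma posSemidef_iff_re {M : Matrix (Fin 4) (Fin 4) ℂ} (hM : M.IsHermitian) :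
    M.PosSemidef ↔ ∀ x : Fin 4 → ℂ, 0 ≤ (star x ⬝ᵥ M *ᵥ x).re := by
  rw [Matrix.posSemidef_iff_dotProduct_mulVec]
  refine ⟨fun h x => (Complex.le_def.1 (h.2 x)).1, fun h => ⟨hM, fun x => ?_⟩⟩
  rw [Complex.le_def]
  exact ⟨h x, by simpa using (hM.im_star_dotProduct_mulVec_self x).symm⟩

lemma isHermitian_choiMat (a f : ℝ) (b c d e g : ℂ) : (choiMat a f b c d e g).IsHermitian := by
  ext i j
  fin_cases i <;> fin_cases j <;> simp [choiMat]

lemma isHermitian_contractionMat (k₁ k₂ k₃ k₄ : ℂ) :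
    (contractionMat k₁ k₂ k₃ k₄).IsHermitian := by
  ext i j
  fin_cases i <;> fin_cases j <;> simp [contractionMat]

lemma isClosed_posSemidef {X : Type*} [TopologicalSpace X] {M : X → Matrix (Fin 4) (Fin 4) ℂ}
    (hM : Continuous M) (hh : ∀ x, (M x).IsHermitian) : IsClosed {x | (M x).PosSemidef} := by
  simp_rw [fun x => posSemidef_iff_re (hh x), Set.ofPred_forall]
  refine isClosed_iInter fun v => isClosed_le continuous_const ?_
  fun_prop

lemma isClosed_qubitChannelSet : IsClosed qubitChannelSet := by
  refine (isClosed_Icc.preimage continuous_fst).inter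
    ((isClosed_Icc.preimage (continuous_fst.comp continuous_snd)).inter
      (isClosed_posSemidef (continuous_matrix fun i j => ?_)
        fun _ => isHermitian_choiMat _ _ _ _ _ _ _))
  fin_cases i <;> fin_cases j <;> simp [choiMat] <;> fun_prop

lemma posSemidef_contractionMat {k₁ k₂ k₃ k₄ : ℂ} (h₁ : ‖k₁‖ ≤ 1 / 2) (h₂ : ‖k₂‖ ≤ 1 / 2)
    (h₃ : ‖k₃‖ ≤ 1 / 2) (h₄ : ‖k₄‖ ≤ 1 / 2) : (contractionMat k₁ k₂ k₃ k₄).PosSemidef := by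
  rw [posSemidef_iff_re (isHermitian_contractionMat _ _ _ _)]
  intro x
  have key (k u v : ℂ) (hk : ‖k‖ ≤ 1 / 2) :
      0 ≤ 1 / 2 * Complex.normSq u + 1 / 2 * Complex.normSq v + 2 * (star u * k * v).re := by
    have h := (abs_le.1 (Complex.abs_re_le_norm (star u * k * v))).1
    rw [norm_mul, norm_mul, norm_star] at h
    rw [Complex.normSq_eq_norm_sq, Complex.normSq_eq_norm_sq]
    have h5 : ‖u‖ * ‖k‖ * ‖v‖ ≤ ‖u‖ * (1 / 2) * ‖v‖ := by gcongr
    nlinarith [sq_nonneg (‖u‖ - ‖v‖)]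
  have e : (star x ⬝ᵥ contractionMat k₁ k₂ k₃ k₄ *ᵥ x).re =
      (1 / 2 * Complex.normSq (x 0) + 1 / 2 * Complex.normSq (x 1) + 2 * (star (x 0) * k₁ * x 1).re) +
      (1 / 2 * Complex.normSq (x 0) + 1 / 2 * Complex.normSq (x 3) + 2 * (star (x 0) * k₂ * x 3).re) +
      (1 / 2 * Complex.normSq (x 1) + 1 / 2 * Complex.normSq (x 2) + 2 * (star (x 1) * k₃ * x 2).re) +
      (1 / 2 * Complex.normSq (x 2) + 1 / 2 * Complex.normSq (x 3) + 2 * (star (x 2) * k₄ * x 3).re) := by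
    simp [contractionMat, dotProduct, Matrix.mulVec, Fin.sum_univ_four, Complex.normSq_apply]
    ring
  rw [e]
  linarith [key _ (x 0) (x 1) h₁, key _ (x 0) (x 3) h₂, key _ (x 1) (x 2) h₃, key _ (x 2) (x 3) h₄]

lemma lintegral_comp_norm_sq {F : ℝ → ENNReal} (hF : Measurable F) :
    ∫⁻ c : ℂ, F (‖c‖ ^ 2) = ENNReal.ofReal π * ∫⁻ u in Set.Ioi 0, F u := by
  have h2 : (fun x : ℝ => x ^ 2) '' Set.Ioi 0 = Set.Ioi 0 := by
    ext y
    refine ⟨?_, fun hy => ⟨√y, Real.sqrt_pos.2 hy, Real.sq_sqrt (le_of_lt hy)⟩⟩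
    rintro ⟨x, hx, rfl⟩
    exact pow_pos (Set.mem_Ioi.1 hx) 2
  have h3 := lintegral_image_eq_lintegral_abs_deriv_mul (s := Set.Ioi (0 : ℝ))
    (f := fun x => x ^ 2) (f' := fun x => 2 * x) measurableSet_Ioi
    (fun x _ => by simpa using (hasDerivAt_pow 2 x).hasDerivWithinAt)
    ((pow_left_strictMonoOn₀ two_ne_zero).injOn.mono Set.Ioi_subset_Ici_self) F
  rw [h2] at h3
  rw [h3, ← Complex.lintegral_comp_polarCoord_symm, polarCoord_target, Measure.volume_eq_prod,
    ← Measure.prod_restrict, lintegral_prod _ (by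
      apply Measurable.aemeasurable
      simp only [smul_eq_mul, Complex.norm_polarCoord_symm]
      fun_prop), ← lintegral_const_mul _ (by fun_prop)]
  refine setLIntegral_congr_fun measurableSet_Ioi fun x hx => ?_
  have hx' : (0 : ℝ) < x := hx
  simp only [Complex.norm_polarCoord_symm, lintegral_const, smul_eq_mul, sq_abs,
    Measure.restrict_apply MeasurableSet.univ, Set.univ_inter, Real.volume_Ioo]
  rw [abs_of_pos (by positivity : 0 < 2 * x), ENNReal.ofReal_mul two_pos.le,
    show π - -π = 2 * π by ring, ENNReal.ofReal_mul two_pos.le]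
  ring

lemma lintegral_comp_real_mul_add {r : ℝ} (hr : r ≠ 0) (t : ℂ) (F : ℂ → ENNReal) :
    ∫⁻ z, F z = ENNReal.ofReal (r ^ 2) * ∫⁻ z, F (r * z + t) := by
  have h := lintegral_comp_smul_add volume hr t F
  simp only [Complex.real_smul, Complex.finrank_real_complex] at h
  rw [h, ← mul_assoc, abs_of_nonneg (by positivity), ← ENNReal.ofReal_mul (by positivity),
    mul_inv_cancel₀ (by positivity), ENNReal.ofReal_one, one_mul]

/-- Indicator function of the positive semidefinite cone. -/
noncomputable def posInd (M : Matrix (Fin 4) (Fin 4) ℂ) : ENNReal :=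
  Set.indicator {M | M.PosSemidef} 1 M

/-- Volume of the set of normalised Choi matrices. -/
noncomputable def contractionVol : ENNReal :=
  ∫⁻ k₁, ∫⁻ k₂, ∫⁻ k₃, ∫⁻ k₄, posInd (contractionMat k₁ k₂ k₃ k₄)

lemma posInd_congr {M N : Matrix (Fin 4) (Fin 4) ℂ} (h : M.PosSemidef ↔ N.PosSemidef) :
    posInd M = posInd N := by
  classical
  simp [posInd, Set.indicator_apply, h]

lemma lintegral_indicator_mul_four (B : Set ℂ) (hB : MeasurableSet B) :
    ∫⁻ k₁, ∫⁻ k₂, ∫⁻ k₃, ∫⁻ k₄, B.indicator 1 k₁ * (B.indicator 1 k₂ * (B.indicator 1 k₃ *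
      B.indicator (1 : ℂ → ENNReal) k₄)) = volume B ^ 4 := by
  have hm : Measurable (B.indicator (1 : ℂ → ENNReal)) := measurable_one.indicator hB
  have ht (k : ℂ) : B.indicator (1 : ℂ → ENNReal) k ≠ ⊤ := by
    classical
    rw [Set.indicator_apply]
    split_ifs <;> simp
  simp only [lintegral_const_mul' _ _ (ht _), lintegral_indicator_one hB, lintegral_mul_const _ hm]
  ring

lemma contractionVol_ne_top : contractionVol ≠ ⊤ := by
  have h : contractionVol ≤ volume (Metric.closedBall (0 : ℂ) 1) ^ 4 := by
    rw [← lintegral_indicator_mul_four _ Metric.isClosed_closedBall.measurableSet]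
    unfold contractionVol
    gcongr with k₁ k₂ k₃ k₄
    classical
    simp only [posInd, Set.indicator_apply, Set.mem_ofPred_eq, mem_closedBall_zero_iff, Pi.one_apply]
    split_ifs with h <;> try simp
    all_goals
      have h1 := norm_sq_le_of_posSemidef h 0 1 (p := 1) (q := 1) (by simp [contractionMat])
        (by simp [contractionMat])
      have h2 := norm_sq_le_of_posSemidef h 0 3 (p := 1) (q := 1) (by simp [contractionMat])
        (by simp [contractionMat])
      have h3 := norm_sq_le_of_posSemidef h 1 2 (p := 1) (q := 1) (by simp [contractionMat])
        (by simp [contractionMat])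
      have h4 := norm_sq_le_of_posSemidef h 2 3 (p := 1) (q := 1) (by simp [contractionMat])
        (by simp [contractionMat])
      simp only [contractionMat, Matrix.of_apply, Matrix.cons_val, mul_one, sq_le_one_iff₀,
        norm_nonneg] at h1 h2 h3 h4
      contradiction
  exact ne_top_of_le_ne_top (ENNReal.pow_ne_top measure_closedBall_lt_top.ne) h

lemma contractionVol_ne_zero : contractionVol ≠ 0 := by
  have h : volume (Metric.closedBall (0 : ℂ) (1 / 2)) ^ 4 ≤ contractionVol := by
    rw [← lintegral_indicator_mul_four _ Metric.isClosed_closedBall.measurableSet]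
    unfold contractionVol
    gcongr with k₁ k₂ k₃ k₄
    classical
    simp only [posInd, Set.indicator_apply, mem_closedBall_zero_iff, Pi.one_apply]
    split_ifs with h1 h2 h3 h4 h <;> try simp
    exact h (posSemidef_contractionMat h1 h2 h3 h4)
  exact (lt_of_lt_of_le (ENNReal.pow_pos
    (Metric.measure_closedBall_pos volume _ (by norm_num)) 4) h).ne'

/-- Volume of the fibre of the channel set over fixed diagonal entries and fixed `c`. -/
noncomputable def offDiagVol (a f : ℝ) (c : ℂ) : ENNReal :=
  ∫⁻ b, ∫⁻ d, ∫⁻ e, ∫⁻ g, posInd (choiMat a f b c d e g)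

lemma offDiagVol_of_lt {a f : ℝ} {c : ℂ} (ha : a ∈ Set.Ioo (0 : ℝ) 1)
    (h₁ : ‖c‖ ^ 2 < a * f) (h₂ : ‖c‖ ^ 2 < (1 - a) * (1 - f)) :
    offDiagVol a f c = contractionVol *
      ENNReal.ofReal ((a * f - ‖c‖ ^ 2) ^ 2 * ((1 - a) * (1 - f) - ‖c‖ ^ 2) ^ 2) := by
  have ha0 : 0 < a := ha.1
  have ha1 : 0 < 1 - a := sub_pos.2 ha.2
  have hl₂ : 0 < f - ‖c‖ ^ 2 / a := by
    rw [sub_pos, div_lt_iff₀ ha0]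
    linarith
  have hm₂ : 0 < 1 - f - ‖c‖ ^ 2 / (1 - a) := by
    rw [sub_pos, div_lt_iff₀ ha1]
    linarith
  obtain ⟨l₁, hl₁0, hl₁⟩ : ∃ l, 0 < l ∧ a = l ^ 2 := ⟨√a, sqrt_pos.2 ha0, (sq_sqrt ha0.le).symm⟩
  obtain ⟨m₁, hm₁0, hm₁⟩ : ∃ l, 0 < l ∧ 1 - a = l ^ 2 :=
    ⟨√(1 - a), sqrt_pos.2 ha1, (sq_sqrt ha1.le).symm⟩
  obtain ⟨l₂, hl₂0, hl₂⟩ : ∃ l, 0 < l ∧ f - ‖c‖ ^ 2 / a = l ^ 2 :=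
    ⟨√_, sqrt_pos.2 hl₂, (sq_sqrt hl₂.le).symm⟩
  obtain ⟨m₂, hm₂0, hm₂⟩ : ∃ l, 0 < l ∧ 1 - f - ‖c‖ ^ 2 / (1 - a) = l ^ 2 :=
    ⟨√_, sqrt_pos.2 hm₂, (sq_sqrt hm₂.le).symm⟩
  have hl₁' : (l₁ : ℂ) ≠ 0 := by exact_mod_cast hl₁0.ne'
  have hm₁' : (m₁ : ℂ) ≠ 0 := by exact_mod_cast hm₁0.ne'
  set l : ℂ := star c / l₁ with hl
  set m : ℂ := -star c / m₁ with hm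
  have hc : c = l₁ * star l := by
    simp [hl]
    field_simp
  have hc' : -c = m₁ * star m := by
    simp [hm]
    field_simp
  have hf : f = Complex.normSq l + l₂ ^ 2 := by
    rw [← hl₂, hl₁, hl, Complex.normSq_eq_norm_sq, norm_div, norm_star, Complex.norm_real,
      div_pow, Real.norm_eq_abs, sq_abs]
    ring
  have hf' : 1 - f = Complex.normSq m + m₂ ^ 2 := by
    rw [← hm₂, hm₁, hm, Complex.normSq_eq_norm_sq, norm_div, norm_neg, norm_star,
      Complex.norm_real, div_pow, Real.norm_eq_abs, sq_abs]
    ring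
  have key := posSemidef_choiMat_iff hl₁ hm₁ hc hc' hf hf' hl₁0.ne' hl₂0.ne' hm₁0.ne' hm₂0.ne'
  have hg (k₁ k₂ k₃ : ℂ) : ∫⁻ g, posInd (choiMat a f (l₁ * m₁ * k₁) c
      (l₁ * m₂ * k₂ + l₁ * star m * k₁) (m₁ * l₂ * k₃ + m₁ * star l * star k₁) g) =
      ENNReal.ofReal ((l₂ * m₂) ^ 2) * ∫⁻ k₄, posInd (contractionMat k₁ k₂ k₃ k₄) := by
    rw [lintegral_comp_real_mul_add (mul_pos hl₂0 hm₂0).ne'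
      (l₂ * star m * star k₃ + l * m₂ * k₂ + l * star m * k₁)]
    congr 1
    refine lintegral_congr fun k₄ => ?_
    rw [← posInd_congr (key k₁ k₂ k₃ k₄)]
    push_cast
    rfl
  have he (k₁ k₂ : ℂ) : ∫⁻ e, ∫⁻ g, posInd (choiMat a f (l₁ * m₁ * k₁) c
      (l₁ * m₂ * k₂ + l₁ * star m * k₁) e g) = ENNReal.ofReal ((m₁ * l₂) ^ 2) *
        (ENNReal.ofReal ((l₂ * m₂) ^ 2) *
          ∫⁻ k₃, ∫⁻ k₄, posInd (contractionMat k₁ k₂ k₃ k₄)) := by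
    rw [lintegral_comp_real_mul_add (mul_pos hm₁0 hl₂0).ne' (m₁ * star l * star k₁)]
    congr 1
    rw [← lintegral_const_mul' _ _ ENNReal.ofReal_ne_top]
    refine lintegral_congr fun k₃ => ?_
    rw [← hg]
    push_cast
    rfl
  have hd (k₁ : ℂ) : ∫⁻ d, ∫⁻ e, ∫⁻ g, posInd (choiMat a f (l₁ * m₁ * k₁) c d e g) =
      ENNReal.ofReal ((l₁ * m₂) ^ 2) * (ENNReal.ofReal ((m₁ * l₂) ^ 2) *
        (ENNReal.ofReal ((l₂ * m₂) ^ 2) *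
          ∫⁻ k₂, ∫⁻ k₃, ∫⁻ k₄, posInd (contractionMat k₁ k₂ k₃ k₄))) := by
    rw [lintegral_comp_real_mul_add (mul_pos hl₁0 hm₂0).ne' (l₁ * star m * k₁)]
    congr 1
    rw [← lintegral_const_mul' _ _ ENNReal.ofReal_ne_top,
      ← lintegral_const_mul' _ _ ENNReal.ofReal_ne_top]
    refine lintegral_congr fun k₂ => ?_
    rw [← he]
    push_cast
    rfl
  have hb : offDiagVol a f c = ENNReal.ofReal ((l₁ * m₁) ^ 2) *
      (ENNReal.ofReal ((l₁ * m₂) ^ 2) * (ENNReal.ofReal ((m₁ * l₂) ^ 2) *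
        (ENNReal.ofReal ((l₂ * m₂) ^ 2) * contractionVol))) := by
    rw [offDiagVol, lintegral_comp_real_mul_add (mul_pos hl₁0 hm₁0).ne' 0, contractionVol]
    congr 1
    rw [← lintegral_const_mul' _ _ ENNReal.ofReal_ne_top,
      ← lintegral_const_mul' _ _ ENNReal.ofReal_ne_top,
      ← lintegral_const_mul' _ _ ENNReal.ofReal_ne_top]
    refine lintegral_congr fun k₁ => ?_
    rw [← hd]
    push_cast
    simp only [add_zero]
  rw [hb, mul_comm contractionVol, ← mul_assoc, ← mul_assoc, ← mul_assoc,
    ← ENNReal.ofReal_mul (by positivity), ← ENNReal.ofReal_mul (by positivity),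
    ← ENNReal.ofReal_mul (by positivity)]
  congr 2
  have e1 : a * f - ‖c‖ ^ 2 = l₁ ^ 2 * l₂ ^ 2 := by
    rw [← hl₂, ← hl₁]
    field_simp
  have e2 : (1 - a) * (1 - f) - ‖c‖ ^ 2 = m₁ ^ 2 * m₂ ^ 2 := by
    rw [← hm₂, ← hm₁]
    field_simp
  rw [e1, e2]
  ring

lemma offDiagVol_of_min_lt {a f : ℝ} {c : ℂ} (h : min (a * f) ((1 - a) * (1 - f)) < ‖c‖ ^ 2) :
    offDiagVol a f c = 0 := by
  have key (b d e g : ℂ) : posInd (choiMat a f b c d e g) = 0 := by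
    refine Set.indicator_of_notMem (fun hp => h.not_ge (le_min ?_ ?_)) _
    · simpa [choiMat] using norm_sq_le_of_posSemidef hp 0 2 (p := a) (q := f) (by simp [choiMat])
        (by simp [choiMat])
    · simpa [choiMat] using norm_sq_le_of_posSemidef hp 1 3 (p := 1 - a) (q := 1 - f)
        (by simp [choiMat]) (by simp [choiMat])
  simp [offDiagVol, key]

lemma lintegral_offDiagVol {a f : ℝ} (ha : a ∈ Set.Ioo (0 : ℝ) 1) (hf : f ∈ Set.Ioo (0 : ℝ) 1) :
    ∫⁻ c, offDiagVol a f c = contractionVol * ENNReal.ofReal π * ENNReal.ofReal (fiberVol a f) := by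
  set s := min (a * f) ((1 - a) * (1 - f)) with hs
  have hs0 : 0 < s := lt_min (mul_pos ha.1 hf.1) (mul_pos (sub_pos.2 ha.2) (sub_pos.2 hf.2))
  set w : ℝ → ℝ := fun u => (a * f - u) ^ 2 * ((1 - a) * (1 - f) - u) ^ 2
  have hw : Continuous w := by fun_prop
  have h1 : ∀ᵐ c : ℂ, offDiagVol a f c =
      contractionVol * (Set.Iio s).indicator (fun u => ENNReal.ofReal (w u)) (‖c‖ ^ 2) := by
    have h0 : volume (Metric.sphere (0 : ℂ) √s) = 0 := Measure.addHaar_sphere _ _ _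
    filter_upwards [measure_eq_zero_iff_ae_notMem.1 h0] with c hc
    rcases lt_trichotomy (‖c‖ ^ 2) s with h | h | h
    · rw [Set.indicator_of_mem (Set.mem_Iio.2 h)]
      exact offDiagVol_of_lt ha (h.trans_le (min_le_left _ _)) (h.trans_le (min_le_right _ _))
    · exact absurd (by rw [mem_sphere_zero_iff_norm, ← h, sqrt_sq (norm_nonneg _)]) hc
    · rw [Set.indicator_of_notMem (by simpa using h.le), mul_zero, offDiagVol_of_min_lt h]
  rw [lintegral_congr_ae h1, lintegral_const_mul' _ _ contractionVol_ne_top,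
    lintegral_comp_norm_sq ((by fun_prop : Measurable fun u => ENNReal.ofReal (w u)).indicator
      measurableSet_Iio), mul_assoc]
  congr 2
  rw [setLIntegral_indicator measurableSet_Iio, Set.inter_comm, Set.Ioi_inter_Iio,
    ← ofReal_integral_eq_lintegral_ofReal, ← integral_Ioc_eq_integral_Ioo,
    ← intervalIntegral.integral_of_le hs0.le, hs, integral_eq_fiberVol]
  · exact (hw.integrableOn_Icc).mono_set Set.Ioo_subset_Icc_self
  · exact Filter.Eventually.of_forall fun u => by positivity

lemma lintegral_prod_five {F : ℂ → ℂ → ℂ → ℂ → ℂ → ENNReal}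
    (hm : Measurable fun r : ℂ × ℂ × ℂ × ℂ × ℂ => F r.1 r.2.1 r.2.2.1 r.2.2.2.1 r.2.2.2.2) :
    ∫⁻ r : ℂ × ℂ × ℂ × ℂ × ℂ, F r.1 r.2.1 r.2.2.1 r.2.2.2.1 r.2.2.2.2 =
      ∫⁻ c, ∫⁻ b, ∫⁻ d, ∫⁻ e, ∫⁻ g, F b c d e g := by
  have hm1 : Measurable fun r : (ℂ × ℂ) × ℂ × ℂ × ℂ => F r.1.1 r.1.2 r.2.1 r.2.2.1 r.2.2.2 :=
    hm.comp (f := fun r : (ℂ × ℂ) × ℂ × ℂ × ℂ => (r.1.1, r.1.2, r.2.1, r.2.2.1, r.2.2.2))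
      (by fun_prop)
  have hm2 (b c : ℂ) : Measurable fun r : ℂ × ℂ × ℂ => F b c r.1 r.2.1 r.2.2 :=
    hm1.comp (measurable_prodMk_left (x := (b, c)))
  have hm3 (b c d : ℂ) : Measurable fun r : ℂ × ℂ => F b c d r.1 r.2 :=
    (hm2 b c).comp (measurable_prodMk_left (x := d))
  rw [Measure.volume_eq_prod, lintegral_prod _ hm.aemeasurable]
  have h1 (b : ℂ) : ∫⁻ r : ℂ × ℂ × ℂ × ℂ, F b r.1 r.2.1 r.2.2.1 r.2.2.2 =
      ∫⁻ c, ∫⁻ r : ℂ × ℂ × ℂ, F b c r.1 r.2.1 r.2.2 := by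
    have hb : Measurable fun r : ℂ × ℂ × ℂ × ℂ => F b r.1 r.2.1 r.2.2.1 r.2.2.2 :=
      hm.comp (measurable_prodMk_left (x := b))
    rw [Measure.volume_eq_prod, lintegral_prod _ hb.aemeasurable]
  have h2 (b c : ℂ) : ∫⁻ r : ℂ × ℂ × ℂ, F b c r.1 r.2.1 r.2.2 =
      ∫⁻ d, ∫⁻ e, ∫⁻ g, F b c d e g := by
    rw [Measure.volume_eq_prod, lintegral_prod _ (hm2 b c).aemeasurable]
    refine lintegral_congr fun d => ?_
    rw [Measure.volume_eq_prod, lintegral_prod _ (hm3 b c d).aemeasurable]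
  simp only [h1]
  rw [lintegral_lintegral_swap hm1.lintegral_prod_right'.aemeasurable]
  simp only [h2]

lemma measurable_posInd_choiMat (a f : ℝ) :
    Measurable fun r : ℂ × ℂ × ℂ × ℂ × ℂ =>
      posInd (choiMat a f r.1 r.2.1 r.2.2.1 r.2.2.2.1 r.2.2.2.2) := by
  have h : IsClosed {r : ℂ × ℂ × ℂ × ℂ × ℂ |
      (choiMat a f r.1 r.2.1 r.2.2.1 r.2.2.2.1 r.2.2.2.2).PosSemidef} := by
    refine isClosed_posSemidef (continuous_matrix fun i j => ?_)
      fun _ => isHermitian_choiMat _ _ _ _ _ _ _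
    fin_cases i <;> fin_cases j <;> simp [choiMat] <;> fun_prop
  exact measurable_one.indicator h.measurableSet

lemma lintegral_posInd_choiMat {a f : ℝ} (ha : a ∈ Set.Ioo (0 : ℝ) 1)
    (hf : f ∈ Set.Ioo (0 : ℝ) 1) :
    ∫⁻ r : ℂ × ℂ × ℂ × ℂ × ℂ, posInd (choiMat a f r.1 r.2.1 r.2.2.1 r.2.2.2.1 r.2.2.2.2) =
      contractionVol * ENNReal.ofReal π * ENNReal.ofReal (fiberVol a f) := by
  rw [lintegral_prod_five (F := fun b c d e g => posInd (choiMat a f b c d e g))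
    (measurable_posInd_choiMat a f)]
  exact lintegral_offDiagVol ha hf

lemma lintegral_indicator_qubitChannelSet {a f : ℝ} (ha : a ∉ ({0, 1} : Set ℝ))
    (hf : f ∉ ({0, 1} : Set ℝ)) :
    ∫⁻ r : ℂ × ℂ × ℂ × ℂ × ℂ, qubitChannelSet.indicator (fun _ => (1 : ENNReal)) (a, f, r) =
      contractionVol * ENNReal.ofReal π * squareDensity a f := by
  classical
  have h (x : ℝ) (hx : x ∉ ({0, 1} : Set ℝ)) :
      x ∈ Set.Icc (0 : ℝ) 1 ↔ x ∈ Set.Ioo (0 : ℝ) 1 := by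
    rw [← Set.Icc_sdiff_both, Set.mem_sdiff]
    exact (and_iff_left hx).symm
  by_cases hq : a ∈ Set.Ioo (0 : ℝ) 1 ∧ f ∈ Set.Ioo (0 : ℝ) 1
  · rw [squareDensity, Set.indicator_of_mem (by exact hq), ← lintegral_posInd_choiMat hq.1 hq.2]
    refine lintegral_congr fun r => ?_
    have ha' := (h a ha).2 hq.1
    have hf' := (h f hf).2 hq.2
    simp only [posInd, Set.indicator_apply, qubitChannelSet, Set.mem_ofPred_eq, ha', hf', true_and,
      Pi.one_apply]
  · rw [squareDensity, Set.indicator_of_notMem (by exact hq), mul_zero]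
    have h0 (r : ℂ × ℂ × ℂ × ℂ × ℂ) :
        qubitChannelSet.indicator (fun _ => (1 : ENNReal)) (a, f, r) = 0 :=
      Set.indicator_of_notMem (fun hp => hq ⟨(h a ha).1 hp.1, (h f hf).1 hp.2.1⟩) _
    simp [h0]

lemma setLIntegral_qubitChannelSet {φ : ℝ → ℝ → ENNReal}
    (hφ : Measurable fun p : ℝ × ℝ => φ p.1 p.2) :
    ∫⁻ p in qubitChannelSet, φ p.1 p.2.1 = contractionVol * ENNReal.ofReal π *
      ∫⁻ a, ∫⁻ f, φ a f * squareDensity a f := by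
  have hS := isClosed_qubitChannelSet.measurableSet
  have hind : Measurable (qubitChannelSet.indicator (fun _ => (1 : ENNReal))) :=
    measurable_const.indicator hS
  have hφ' : Measurable fun p : ℝ × ℝ × ℂ × ℂ × ℂ × ℂ × ℂ => φ p.1 p.2.1 :=
    hφ.comp (f := fun p : ℝ × ℝ × ℂ × ℂ × ℂ × ℂ × ℂ => (p.1, p.2.1)) (by fun_prop)
  have hm : Measurable fun p : ℝ × ℝ × ℂ × ℂ × ℂ × ℂ × ℂ =>
      φ p.1 p.2.1 * qubitChannelSet.indicator (fun _ => 1) p := hφ'.mul hind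
  have hK : contractionVol * ENNReal.ofReal π ≠ ⊤ :=
    ENNReal.mul_ne_top contractionVol_ne_top ENNReal.ofReal_ne_top
  have hae : ∀ᵐ x : ℝ, x ∉ ({0, 1} : Set ℝ) :=
    measure_eq_zero_iff_ae_notMem.1 ((Set.toFinite _).measure_zero _)
  have h1 : ∫⁻ p in qubitChannelSet, φ p.1 p.2.1 =
      ∫⁻ p, φ p.1 p.2.1 * qubitChannelSet.indicator (fun _ => 1) p := by
    rw [← lintegral_indicator hS]
    refine lintegral_congr fun p => ?_
    by_cases hp : p ∈ qubitChannelSet <;> simp [hp]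
  rw [h1, Measure.volume_eq_prod, lintegral_prod _ hm.aemeasurable, ← lintegral_const_mul' _ _ hK]
  refine lintegral_congr_ae ?_
  filter_upwards [hae] with a ha
  have hma : Measurable fun q : ℝ × ℂ × ℂ × ℂ × ℂ × ℂ =>
      φ a q.1 * qubitChannelSet.indicator (fun _ => 1) (a, q) :=
    hm.comp (measurable_prodMk_left (x := a))
  rw [Measure.volume_eq_prod, lintegral_prod _ hma.aemeasurable, ← lintegral_const_mul' _ _ hK]
  refine lintegral_congr_ae ?_
  filter_upwards [hae] with f hf
  have h2 : Measurable fun r : ℂ × ℂ × ℂ × ℂ × ℂ =>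
      qubitChannelSet.indicator (fun _ => (1 : ENNReal)) (a, f, r) :=
    hind.comp (f := fun r : ℂ × ℂ × ℂ × ℂ × ℂ => (a, f, r)) (by fun_prop)
  rw [lintegral_const_mul _ h2, lintegral_indicator_qubitChannelSet ha hf]
  ring

lemma isAddHaarMeasure_volume_prod {E F : Type*} [NormedAddCommGroup E] [NormedAddCommGroup F]
    [MeasureSpace E] [MeasureSpace F] [BorelSpace E] [BorelSpace F]
    [SecondCountableTopology E] [SecondCountableTopology F]
    [SigmaFinite (volume : Measure E)] [SigmaFinite (volume : Measure F)]
    [(volume : Measure E).IsAddHaarMeasure] [(volume : Measure F).IsAddHaarMeasure] :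
    (volume : Measure (E × F)).IsAddHaarMeasure :=
  Measure.prod.instIsAddHaarMeasure _ _

instance isAddHaarMeasure_volume_params :
    (volume : Measure (ℝ × ℝ × ℂ × ℂ × ℂ × ℂ × ℂ)).IsAddHaarMeasure := by
  have h2 : (volume : Measure (ℂ × ℂ)).IsAddHaarMeasure := isAddHaarMeasure_volume_prod
  have h3 : (volume : Measure (ℂ × ℂ × ℂ)).IsAddHaarMeasure := isAddHaarMeasure_volume_prod
  have h4 : (volume : Measure (ℂ × ℂ × ℂ × ℂ)).IsAddHaarMeasure := isAddHaarMeasure_volume_prod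
  have h5 : (volume : Measure (ℂ × ℂ × ℂ × ℂ × ℂ)).IsAddHaarMeasure :=
    isAddHaarMeasure_volume_prod
  have h6 : (volume : Measure (ℝ × ℂ × ℂ × ℂ × ℂ × ℂ)).IsAddHaarMeasure :=
    isAddHaarMeasure_volume_prod
  exact isAddHaarMeasure_volume_prod

/-- Linear part of the action on channel parameters of conjugating the output state by
the Hermitian unitary with rows `(x, y)` and `(star y, -x)`. -/
noncomputable def conjLinear (x : ℝ) (y : ℂ) :
    (ℝ × ℝ × ℂ × ℂ × ℂ × ℂ × ℂ) →ₗ[ℝ] ℝ × ℝ × ℂ × ℂ × ℂ × ℂ × ℂ where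
  toFun p := ((x ^ 2 - Complex.normSq y) * p.1 + 2 * x * (y.re * p.2.2.1.re + y.im * p.2.2.1.im),
    (x ^ 2 - Complex.normSq y) * p.2.1 +
      2 * x * (y.re * p.2.2.2.2.2.2.re + y.im * p.2.2.2.2.2.2.im),
    2 * x * y * p.1 + y ^ 2 * star p.2.2.1 - x ^ 2 * p.2.2.1,
    (x ^ 2 - y * star y) * p.2.2.2.1 + x * (y * p.2.2.2.2.2.1 + star y * p.2.2.2.2.1),
    2 * x * y * p.2.2.2.1 + y ^ 2 * p.2.2.2.2.2.1 - x ^ 2 * p.2.2.2.2.1,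
    2 * x * star y * p.2.2.2.1 + star y ^ 2 * p.2.2.2.2.1 - x ^ 2 * p.2.2.2.2.2.1,
    2 * x * y * p.2.1 + y ^ 2 * star p.2.2.2.2.2.2 - x ^ 2 * p.2.2.2.2.2.2)
  map_add' p q := by
    ext <;> simp <;> ring
  map_smul' r p := by
    ext <;> simp <;> ring

/-- The action on channel parameters of conjugating the output state by
the Hermitian unitary with rows `(x, y)` and `(star y, -x)`. -/
noncomputable def conjAffine (x : ℝ) (y : ℂ) (p : ℝ × ℝ × ℂ × ℂ × ℂ × ℂ × ℂ) :
    ℝ × ℝ × ℂ × ℂ × ℂ × ℂ × ℂ :=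
  conjLinear x y p + (Complex.normSq y, Complex.normSq y, -(x * y), 0, 0, 0, -(x * y))

/-- The Choi matrix of a parameter tuple. -/
noncomputable def paramMat (p : ℝ × ℝ × ℂ × ℂ × ℂ × ℂ × ℂ) : Matrix (Fin 4) (Fin 4) ℂ :=
  choiMat p.1 p.2.1 p.2.2.1 p.2.2.2.1 p.2.2.2.2.1 p.2.2.2.2.2.1 p.2.2.2.2.2.2

lemma paramMat_injective : Function.Injective paramMat := by
  intro p q h
  have h' (i j : Fin 4) : paramMat p i j = paramMat q i j := by rw [h]
  have h00 := h' 0 0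
  have h22 := h' 2 2
  have h01 := h' 0 1
  have h02 := h' 0 2
  have h03 := h' 0 3
  have h12 := h' 1 2
  have h23 := h' 2 3
  simp only [paramMat, choiMat, Matrix.of_apply, Matrix.cons_val] at h00 h22 h01 h02 h03 h12 h23
  exact Prod.ext (by exact_mod_cast h00) (Prod.ext (by exact_mod_cast h22) (Prod.ext h01
    (Prod.ext h02 (Prod.ext h03 (Prod.ext h12 h23)))))

/-- Two copies of the Hermitian unitary with rows `(x, y)` and `(star y, -x)`. -/
noncomputable def unitaryPair (x : ℝ) (y : ℂ) : Matrix (Fin 4) (Fin 4) ℂ :=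
  !![(x : ℂ), y, 0, 0;
     star y, -(x : ℂ), 0, 0;
     0, 0, (x : ℂ), y;
     0, 0, star y, -(x : ℂ)]

lemma star_unitaryPair (x : ℝ) (y : ℂ) : star (unitaryPair x y) = unitaryPair x y := by
  ext i j
  fin_cases i <;> fin_cases j <;> simp [unitaryPair, Matrix.star_apply]

lemma ofReal_sq_add_mul_conj {x : ℝ} {y : ℂ} (h : x ^ 2 + Complex.normSq y = 1) :
    (x : ℂ) ^ 2 + y * (starRingEnd ℂ) y = 1 := by
  rw [Complex.mul_conj]
  exact_mod_cast h

lemma unitaryPair_mul_self {x : ℝ} {y : ℂ} (h : x ^ 2 + Complex.normSq y = 1) :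
    unitaryPair x y * unitaryPair x y = 1 := by
  have h' := ofReal_sq_add_mul_conj h
  ext i j
  fin_cases i <;> fin_cases j <;>
    simp [unitaryPair, Matrix.mul_apply, Fin.sum_univ_four] <;>
    first | ring1 | linear_combination h'

lemma paramMat_conjAffine {x : ℝ} {y : ℂ} (h : x ^ 2 + Complex.normSq y = 1)
    (p : ℝ × ℝ × ℂ × ℂ × ℂ × ℂ × ℂ) :
    paramMat (conjAffine x y p) = unitaryPair x y * paramMat p * unitaryPair x y := by
  have h' := ofReal_sq_add_mul_conj h
  obtain ⟨a, f, b, c, d, e, g⟩ := p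
  have hn : (Complex.normSq y : ℂ) = y * star y := by rw [← starRingEnd_apply, Complex.mul_conj]
  have hr (z : ℂ) : ((2 * x * (y.re * z.re + y.im * z.im) : ℝ) : ℂ) =
      x * (star y * z + y * star z) := by
    apply Complex.ext
    · simp
      ring
    · simp
      exact Or.inr (by ring)
  have ha (a : ℝ) (b : ℂ) : (((x ^ 2 - Complex.normSq y) * a +
      2 * x * (y.re * b.re + y.im * b.im) + Complex.normSq y : ℝ) : ℂ) =
      (x ^ 2 - y * star y) * a + x * (star y * b + y * star b) + y * star y := by
    rw [Complex.ofReal_add, Complex.ofReal_add, hr, ← hn]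
    push_cast
    rfl
  simp only [paramMat, conjAffine, conjLinear, LinearMap.coe_mk, AddHom.coe_mk, Prod.mk_add_mk]
  unfold choiMat
  rw [ha, ha]
  ext i j
  fin_cases i <;> fin_cases j <;>
    simp [unitaryPair, Matrix.mul_apply, Fin.sum_univ_four] <;>
    first | ring1 | linear_combination h' | linear_combination (-1 : ℂ) * h'

lemma conjAffine_conjAffine {x : ℝ} {y : ℂ} (h : x ^ 2 + Complex.normSq y = 1)
    (p : ℝ × ℝ × ℂ × ℂ × ℂ × ℂ × ℂ) : conjAffine x y (conjAffine x y p) = p := by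
  apply paramMat_injective
  rw [paramMat_conjAffine h, paramMat_conjAffine h]
  simp only [← mul_assoc]
  rw [unitaryPair_mul_self h, one_mul, mul_assoc, unitaryPair_mul_self h, mul_one]

lemma conjLinear_comp_self {x : ℝ} {y : ℂ} (h : x ^ 2 + Complex.normSq y = 1) :
    conjLinear x y ∘ₗ conjLinear x y = LinearMap.id := by
  refine LinearMap.ext fun p => ?_
  have h1 := conjAffine_conjAffine h p
  have h0 := conjAffine_conjAffine h 0
  simp only [conjAffine, map_add, map_zero, zero_add] at h0 h1
  rw [add_assoc, h0, add_zero] at h1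
  exact h1

set_option maxSynthPendingDepth 10 in
set_option synthInstance.maxSize 1000 in
lemma measurePreserving_conjAffine {x : ℝ} {y : ℂ} (h : x ^ 2 + Complex.normSq y = 1) :
    MeasurePreserving (conjAffine x y) := by
  have hd : LinearMap.det (conjLinear x y) * LinearMap.det (conjLinear x y) = 1 := by
    rw [← LinearMap.det_comp, conjLinear_comp_self h, LinearMap.det_id]
  have hL : MeasurePreserving (conjLinear x y) := by
    refine ⟨(LinearMap.continuous_of_finiteDimensional _).measurable, ?_⟩
    rw [Measure.map_linearMap_addHaar_eq_smul_addHaar _ (left_ne_zero_of_mul_eq_one hd)]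
    rcases mul_self_eq_one_iff.1 hd with h1 | h1 <;> simp [h1]
  exact (measurePreserving_add_right volume _).comp hL

lemma mem_qubitChannelSet_iff {p : ℝ × ℝ × ℂ × ℂ × ℂ × ℂ × ℂ} :
    p ∈ qubitChannelSet ↔ (paramMat p).PosSemidef := by
  refine ⟨fun h => h.2.2, fun h => ⟨?_, ?_, h⟩⟩
  · have h0 := h.diag_nonneg (i := 0)
    have h1 := h.diag_nonneg (i := 1)
    simp only [paramMat, choiMat, Matrix.of_apply, Matrix.cons_val] at h0 h1
    exact ⟨by exact_mod_cast h0, sub_nonneg.1 (by exact_mod_cast h1)⟩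
  · have h0 := h.diag_nonneg (i := 2)
    have h1 := h.diag_nonneg (i := 3)
    simp only [paramMat, choiMat, Matrix.of_apply, Matrix.cons_val] at h0 h1
    exact ⟨by exact_mod_cast h0, sub_nonneg.1 (by exact_mod_cast h1)⟩

lemma preimage_conjAffine_qubitChannelSet {x : ℝ} {y : ℂ} (h : x ^ 2 + Complex.normSq y = 1) :
    conjAffine x y ⁻¹' qubitChannelSet = qubitChannelSet := by
  ext p
  have hu : IsUnit (unitaryPair x y) := .of_mul_eq_one _ (unitaryPair_mul_self h)
  rw [Set.mem_preimage, mem_qubitChannelSet_iff, mem_qubitChannelSet_iff, paramMat_conjAffine h]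
  have hc := hu.posSemidef_star_right_conjugate_iff (x := paramMat p)
  rwa [star_unitaryPair] at hc

/-- Bloch vector of the image of the state with Bloch vector `(0, 0, r₀)`. -/
noncomputable def blochImage (r₀ : ℝ) (p : ℝ × ℝ × ℂ × ℂ × ℂ × ℂ × ℂ) : EuclideanSpace ℝ (Fin 3) :=
  !₂[(p.2.2.1 + p.2.2.2.2.2.2).re + r₀ * (p.2.2.1 - p.2.2.2.2.2.2).re,
    -(p.2.2.1 + p.2.2.2.2.2.2).im + r₀ * (p.2.2.2.2.2.2 - p.2.2.1).im,
    p.1 + p.2.1 - 1 + r₀ * (p.1 - p.2.1)]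

lemma continuous_blochImage (r₀ : ℝ) : Continuous (blochImage r₀) := by
  refine (PiLp.continuous_toLp 2 _).comp (continuous_pi fun i => ?_)
  fin_cases i <;> simp <;> fun_prop

lemma blochImage_conjAffine {x : ℝ} {y : ℂ} (h : x ^ 2 + Complex.normSq y = 1) (r₀ : ℝ)
    (p : ℝ × ℝ × ℂ × ℂ × ℂ × ℂ × ℂ) :
    blochImage r₀ (conjAffine x y p) 2 =
      inner ℝ !₂[2 * x * y.re, -(2 * x * y.im), x ^ 2 - Complex.normSq y] (blochImage r₀ p) := by
  simp only [blochImage, conjAffine, conjLinear, LinearMap.coe_mk, AddHom.coe_mk, Prod.fst_add,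
    Prod.snd_add, PiLp.inner_apply, Fin.sum_univ_three, PiLp.toLp_apply, Matrix.cons_val,
    RCLike.inner_apply, conj_trivial, Complex.add_re, Complex.sub_re, Complex.add_im,
    Complex.sub_im]
  linear_combination h

lemma exists_conj_of_norm_eq_one {v : EuclideanSpace ℝ (Fin 3)} (hv : ‖v‖ = 1) :
    ∃ (x : ℝ) (y : ℂ), x ^ 2 + Complex.normSq y = 1 ∧
      v = !₂[2 * x * y.re, -(2 * x * y.im), x ^ 2 - Complex.normSq y] := by
  have h : v 0 ^ 2 + v 1 ^ 2 + v 2 ^ 2 = 1 := by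
    have := EuclideanSpace.real_norm_sq_eq v
    rw [hv, Fin.sum_univ_three] at this
    linarith
  by_cases h2 : v 2 = -1
  · have h0 : v 0 = 0 := by
      rw [h2] at h
      nlinarith [sq_nonneg (v 0), sq_nonneg (v 1)]
    have h1 : v 1 = 0 := by
      rw [h2] at h
      nlinarith [sq_nonneg (v 0), sq_nonneg (v 1)]
    refine ⟨0, 1, by simp, ?_⟩
    ext i
    fin_cases i <;> simp [h0, h1, h2]
  · have hpos : 0 < (1 + v 2) / 2 := by
      have : -1 ≤ v 2 := by nlinarith [sq_nonneg (v 0), sq_nonneg (v 1)]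
      have := lt_of_le_of_ne this (Ne.symm h2)
      linarith
    obtain ⟨x, hx, hx2⟩ : ∃ x, 0 < x ∧ (1 + v 2) / 2 = x ^ 2 :=
      ⟨√_, sqrt_pos.2 hpos, (sq_sqrt hpos.le).symm⟩
    have hv2 : v 2 = 2 * x ^ 2 - 1 := by linarith
    have hn : Complex.normSq ⟨v 0 / (2 * x), -(v 1 / (2 * x))⟩ = 1 - x ^ 2 := by
      rw [Complex.normSq_apply]
      rw [hv2] at h
      field_simp
      linear_combination h
    refine ⟨x, ⟨v 0 / (2 * x), -(v 1 / (2 * x))⟩, by rw [hn]; ring, ?_⟩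
    ext i
    fin_cases i
    · simp
      field_simp
    · simp
      field_simp
    · simp only [hn]
      simp [hv2]
      ring

lemma setLIntegral_inner_blochImage_of_norm_eq_one {v : EuclideanSpace ℝ (Fin 3)} (hv : ‖v‖ = 1)
    (r₀ : ℝ) (k : ℕ) :
    ∫⁻ p in qubitChannelSet, ENNReal.ofReal (inner ℝ v (blochImage r₀ p) ^ (2 * k)) =
      ∫⁻ p in qubitChannelSet, ENNReal.ofReal (blochImage r₀ p 2 ^ (2 * k)) := by
  obtain ⟨x, y, h, rfl⟩ := exists_conj_of_norm_eq_one hv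
  have hT := (measurePreserving_conjAffine h).restrict_preimage
    isClosed_qubitChannelSet.measurableSet
  rw [preimage_conjAffine_qubitChannelSet h] at hT
  have hm : Measurable fun p => ENNReal.ofReal (blochImage r₀ p 2 ^ (2 * k)) := by
    have := continuous_blochImage r₀
    fun_prop
  rw [← hT.lintegral_comp hm]
  simp only [blochImage_conjAffine h]

lemma setLIntegral_inner_blochImage (v : EuclideanSpace ℝ (Fin 3)) (r₀ : ℝ) (k : ℕ) :
    ∫⁻ p in qubitChannelSet, ENNReal.ofReal (inner ℝ v (blochImage r₀ p) ^ (2 * k)) =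
      ENNReal.ofReal (‖v‖ ^ (2 * k)) *
        ∫⁻ p in qubitChannelSet, ENNReal.ofReal (blochImage r₀ p 2 ^ (2 * k)) := by
  obtain ⟨u, hu, huv⟩ : ∃ u : EuclideanSpace ℝ (Fin 3), ‖u‖ = 1 ∧ v = ‖v‖ • u := by
    by_cases hv : v = 0
    · exact ⟨EuclideanSpace.single 0 1, by simp, by simp [hv]⟩
    · exact ⟨(‖v‖)⁻¹ • v, norm_smul_inv_norm hv, by rw [smul_inv_smul₀ (norm_ne_zero_iff.2 hv)]⟩
  rw [← setLIntegral_inner_blochImage_of_norm_eq_one hu,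
    ← lintegral_const_mul' _ _ ENNReal.ofReal_ne_top]
  refine lintegral_congr fun p => ?_
  conv_lhs => rw [huv]
  rw [real_inner_smul_left, mul_pow, ENNReal.ofReal_mul (by positivity)]

lemma integral_Ioi_pow_mul_exp_neg_sq (k : ℕ) :
    ∫ x in Set.Ioi (0 : ℝ), x ^ (2 * k) * exp (-x ^ 2) = 1 / 2 * Gamma (k + 1 / 2) := by
  have h := integral_rpow_mul_exp_neg_rpow (p := 2) (q := ((2 * k : ℕ) : ℝ)) two_pos
    (by linarith [Nat.cast_nonneg (α := ℝ) (2 * k)])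
  simp only [rpow_natCast, rpow_ofNat] at h
  rw [h]
  congr 2
  push_cast
  ring

lemma integrableOn_Ioi_pow_mul_exp_neg_sq (n : ℕ) :
    IntegrableOn (fun x : ℝ => x ^ n * exp (-x ^ 2)) (Set.Ioi 0) := by
  have h := integrableOn_rpow_mul_exp_neg_rpow (p := 2) (s := (n : ℝ))
    (by linarith [Nat.cast_nonneg (α := ℝ) n]) two_pos
  simpa only [rpow_natCast, rpow_ofNat] using h

lemma integral_pow_mul_exp_neg_sq (k : ℕ) :
    ∫ x : ℝ, x ^ (2 * k) * exp (-x ^ 2) = Gamma (k + 1 / 2) := by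
  have h := integral_comp_abs (f := fun x => x ^ (2 * k) * exp (-x ^ 2))
  simp only [pow_mul, sq_abs] at h ⊢
  rw [h]
  simp only [← pow_mul]
  rw [integral_Ioi_pow_mul_exp_neg_sq]
  ring

lemma integrable_norm_pow_mul_exp_neg_norm_sq (k : ℕ) :
    Integrable fun v : EuclideanSpace ℝ (Fin 3) => ‖v‖ ^ (2 * k) * exp (-‖v‖ ^ 2) := by
  rw [integrable_fun_norm_addHaar volume (f := fun x => x ^ (2 * k) * exp (-x ^ 2))]
  refine (integrableOn_Ioi_pow_mul_exp_neg_sq (2 + 2 * k)).congr_fun (fun x _ => ?_)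
    measurableSet_Ioi
  simp [pow_add, mul_assoc]

lemma integral_coord_pow_mul_exp_neg_norm_sq (k : ℕ) :
    ∫ v : EuclideanSpace ℝ (Fin 3), v 2 ^ (2 * k) * exp (-‖v‖ ^ 2) =
      Gamma (1 / 2) ^ 2 * Gamma (k + 1 / 2) := by
  have h := integral_fintype_prod_volume_eq_prod (𝕜 := ℝ)
    (fun (i : Fin 3) (x : ℝ) => x ^ (2 * (![0, 0, k] i)) * exp (-x ^ 2))
  simp only [integral_pow_mul_exp_neg_sq, Fin.prod_univ_three, Matrix.cons_val] at h
  rw [← (PiLp.volume_preserving_toLp (Fin 3)).integral_comp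
    (MeasurableEquiv.toLp 2 (Fin 3 → ℝ)).measurableEmbedding]
  refine Eq.trans (integral_congr_ae (Filter.Eventually.of_forall fun x => ?_)) (h.trans ?_)
  · simp only [EuclideanSpace.real_norm_sq_eq, Fin.sum_univ_three, neg_add,
      Real.exp_add]
    ring
  · push_cast
    rw [zero_add]
    ring

lemma integral_norm_pow_mul_exp_neg_norm_sq (k : ℕ) :
    ∫ v : EuclideanSpace ℝ (Fin 3), ‖v‖ ^ (2 * k) * exp (-‖v‖ ^ 2) =
      (2 * k + 1) * ∫ v : EuclideanSpace ℝ (Fin 3), v 2 ^ (2 * k) * exp (-‖v‖ ^ 2) := by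
  have h (k : ℕ) : ∫ v : EuclideanSpace ℝ (Fin 3), ‖v‖ ^ (2 * k) * exp (-‖v‖ ^ 2) =
      3 * volume.real (Metric.ball (0 : EuclideanSpace ℝ (Fin 3)) 1) *
        (1 / 2 * ((k + 1 / 2) * Gamma (k + 1 / 2))) := by
    rw [integral_fun_norm_addHaar volume (fun x => x ^ (2 * k) * exp (-x ^ 2)),
      ← Gamma_add_one (by positivity), add_right_comm]
    have := integral_Ioi_pow_mul_exp_neg_sq (k + 1)
    push_cast at this
    have h2 (x : ℝ) : x ^ (3 - 1) • (x ^ (2 * k) * exp (-x ^ 2)) =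
        x ^ (2 * (k + 1)) * exp (-x ^ 2) := by
      rw [smul_eq_mul]
      ring
    simp only [← this, finrank_euclideanSpace_fin, h2, nsmul_eq_mul, smul_eq_mul, mul_assoc]
    norm_cast
  have h0 := h 0
  have h1 := integral_coord_pow_mul_exp_neg_norm_sq 0
  simp only [mul_zero, pow_zero] at h0 h1
  rw [h1] at h0
  rw [h, integral_coord_pow_mul_exp_neg_norm_sq]
  have hG : 0 < Gamma (1 / 2) := Gamma_pos_of_pos (by norm_num)
  simp only [Nat.cast_zero, zero_add] at h0
  have h2 : Gamma (1 / 2) ^ 2 =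
      3 * volume.real (Metric.ball (0 : EuclideanSpace ℝ (Fin 3)) 1) / 4 := by
    refine mul_right_cancel₀ hG.ne' ?_
    linear_combination h0
  rw [h2]
  ring

lemma integrable_coord_pow_mul_exp_neg_norm_sq (k : ℕ) :
    Integrable fun v : EuclideanSpace ℝ (Fin 3) => v 2 ^ (2 * k) * exp (-‖v‖ ^ 2) := by
  refine (integrable_norm_pow_mul_exp_neg_norm_sq k).mono' (by fun_prop)
    (Filter.Eventually.of_forall fun v => ?_)
  rw [norm_mul, norm_pow, Real.norm_of_nonneg (exp_pos _).le]
  gcongr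
  exact PiLp.norm_apply_le v 2

lemma lintegral_exp_mul_inner_pow (w : EuclideanSpace ℝ (Fin 3)) (k : ℕ) :
    ∫⁻ v : EuclideanSpace ℝ (Fin 3),
        ENNReal.ofReal (exp (-‖v‖ ^ 2)) * ENNReal.ofReal (inner ℝ v w ^ (2 * k)) =
      ENNReal.ofReal (‖w‖ ^ (2 * k)) * ENNReal.ofReal
        (∫ v : EuclideanSpace ℝ (Fin 3), v 2 ^ (2 * k) * exp (-‖v‖ ^ 2)) := by
  set e : EuclideanSpace ℝ (Fin 3) := ‖w‖ • EuclideanSpace.single 2 1 with he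
  have hn : ‖w‖ = ‖e‖ := by simp [he, norm_smul]
  obtain ⟨R, hR⟩ : ∃ R : EuclideanSpace ℝ (Fin 3) ≃ₗᵢ[ℝ] EuclideanSpace ℝ (Fin 3), R e = w :=
    ⟨(ℝ ∙ (e - w))ᗮ.reflection, Submodule.reflection_sub hn.symm⟩
  rw [ofReal_integral_eq_lintegral_ofReal (integrable_coord_pow_mul_exp_neg_norm_sq k)
    (Filter.Eventually.of_forall fun v => mul_nonneg ((even_two_mul k).pow_nonneg _)
      (exp_pos _).le),
    ← lintegral_const_mul' _ _ ENNReal.ofReal_ne_top,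
    ← R.measurePreserving.lintegral_comp (by fun_prop)]
  refine lintegral_congr fun v => ?_
  have h1 : inner ℝ (R v) w = ‖w‖ * v 2 := by
    rw [← hR, R.inner_map_map, hR, he, real_inner_smul_right, EuclideanSpace.inner_single_right]
    simp
  rw [h1, R.norm_map, mul_pow, ENNReal.ofReal_mul (by positivity),
    ENNReal.ofReal_mul ((even_two_mul k).pow_nonneg _)]
  ring

/-- For a rotation invariant random vector, even moments of the norm are determined by those
of one coordinate. -/
lemma lintegral_norm_pow_eq {X : Type*} [MeasurableSpace X] {ν : Measure X} [SFinite ν]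
    {Y : X → EuclideanSpace ℝ (Fin 3)} (hY : Measurable Y) {k : ℕ} {M : ENNReal}
    (h : ∀ v, ∫⁻ p, ENNReal.ofReal (inner ℝ v (Y p) ^ (2 * k)) ∂ν =
      ENNReal.ofReal (‖v‖ ^ (2 * k)) * M) :
    ∫⁻ p, ENNReal.ofReal (‖Y p‖ ^ (2 * k)) ∂ν = ENNReal.ofReal (2 * k + 1) * M := by
  set B := ∫ v : EuclideanSpace ℝ (Fin 3), v 2 ^ (2 * k) * exp (-‖v‖ ^ 2) with hB
  have hB0 : 0 < B := by
    rw [hB, integral_coord_pow_mul_exp_neg_norm_sq]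
    have h1 := Gamma_pos_of_pos (s := 1 / 2) (by norm_num)
    have h2 := Gamma_pos_of_pos (s := (k : ℝ) + 1 / 2) (by positivity)
    positivity
  have hm : Measurable fun q : EuclideanSpace ℝ (Fin 3) × X => ENNReal.ofReal (exp (-‖q.1‖ ^ 2)) *
      ENNReal.ofReal (inner ℝ q.1 (Y q.2) ^ (2 * k)) := by fun_prop
  have h1 := lintegral_lintegral_swap (μ := volume) (ν := ν)
    (f := fun v p => ENNReal.ofReal (exp (-‖v‖ ^ 2)) *
      ENNReal.ofReal (inner ℝ v (Y p) ^ (2 * k))) hm.aemeasurable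
  simp only [lintegral_exp_mul_inner_pow, lintegral_const_mul' _ _ ENNReal.ofReal_ne_top, h,
    lintegral_mul_const' _ _ ENNReal.ofReal_ne_top, ← mul_assoc] at h1
  rw [lintegral_mul_const _ (by fun_prop), ← hB] at h1
  have h2 : ∫⁻ v : EuclideanSpace ℝ (Fin 3), ENNReal.ofReal (exp (-‖v‖ ^ 2)) *
      ENNReal.ofReal (‖v‖ ^ (2 * k)) = ENNReal.ofReal (2 * k + 1) * ENNReal.ofReal B := by
    rw [← ENNReal.ofReal_mul (by positivity), hB, ← integral_norm_pow_mul_exp_neg_norm_sq,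
      ofReal_integral_eq_lintegral_ofReal (integrable_norm_pow_mul_exp_neg_norm_sq k)
        (Filter.Eventually.of_forall fun v => by positivity)]
    refine lintegral_congr fun v => ?_
    rw [ENNReal.ofReal_mul (by positivity), mul_comm]
  rw [h2] at h1
  refine (ENNReal.mul_left_inj (ENNReal.ofReal_pos.2 hB0).ne' ENNReal.ofReal_ne_top).1 ?_
  rw [← h1]
  ring

lemma integrable_pow_of_ae_mem_Icc {μ : Measure ℝ} [IsFiniteMeasure μ]
    (hμ : ∀ᵐ x ∂μ, x ∈ Set.Icc (0 : ℝ) 1) (n : ℕ) : Integrable (fun x => x ^ n) μ := by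
  refine Integrable.of_bound (by fun_prop) 1 (hμ.mono fun x hx => ?_)
  rw [norm_pow, Real.norm_of_nonneg hx.1]
  exact pow_le_one₀ hx.1 hx.2

lemma abs_integral_sub_eval_sq_le {μ : Measure ℝ} [IsFiniteMeasure μ]
    (hμ : ∀ᵐ x ∂μ, x ∈ Set.Icc (0 : ℝ) 1) (f : BoundedContinuousFunction ℝ ℝ) {p : Polynomial ℝ}
    {ε : ℝ} (hp : ∀ t ∈ Set.Icc (0 : ℝ) 1, |p.eval t - f (√t)| < ε) :
    |∫ x, f x ∂μ - ∑ i ∈ Finset.range (p.natDegree + 1), p.coeff i * ∫ x, x ^ (2 * i) ∂μ| ≤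
      ε * μ.real Set.univ := by
  have hi (i : ℕ) : Integrable (fun x => p.coeff i * x ^ (2 * i)) μ :=
    (integrable_pow_of_ae_mem_Icc hμ _).const_mul _
  simp only [← integral_const_mul]
  rw [← integral_finsetSum _ fun i _ => hi i, ← integral_sub (f.integrable μ)
    (integrable_finsetSum _ fun i _ => hi i), ← Real.norm_eq_abs]
  refine norm_integral_le_of_norm_le_const (hμ.mono fun x hx => ?_)
  have h := hp (x ^ 2) ⟨by positivity, pow_le_one₀ hx.1 hx.2⟩
  rw [sqrt_sq hx.1, Polynomial.eval_eq_sum_range] at h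
  rw [norm_sub_rev, Real.norm_eq_abs]
  simpa only [pow_mul] using h.le

/-- Finite measures on `[0, 1]` are determined by their even moments. -/
lemma ext_of_lintegral_even_pow_eq {μ ν : Measure ℝ} [IsFiniteMeasure μ] [IsFiniteMeasure ν]
    (hμ : ∀ᵐ x ∂μ, x ∈ Set.Icc (0 : ℝ) 1) (hν : ∀ᵐ x ∂ν, x ∈ Set.Icc (0 : ℝ) 1)
    (h : ∀ k : ℕ, ∫⁻ x, ENNReal.ofReal (x ^ (2 * k)) ∂μ = ∫⁻ x, ENNReal.ofReal (x ^ (2 * k)) ∂ν) :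
    μ = ν := by
  have h' (k : ℕ) : ∫ x, x ^ (2 * k) ∂μ = ∫ x, x ^ (2 * k) ∂ν := by
    have h0 (x : ℝ) : 0 ≤ x ^ (2 * k) := (even_two_mul k).pow_nonneg x
    rw [integral_eq_lintegral_of_nonneg_ae (.of_forall h0) (by fun_prop),
      integral_eq_lintegral_of_nonneg_ae (.of_forall h0) (by fun_prop), h]
  refine ext_of_forall_integral_eq_of_IsFiniteMeasure fun f => ?_
  set C := μ.real Set.univ + ν.real Set.univ with hC
  have hC0 : 0 ≤ C := by positivity
  refine eq_of_abs_sub_le_all fun ε hε => ?_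
  obtain ⟨p, hp⟩ := exists_polynomial_near_of_continuousOn 0 1 (fun t => f (√t))
    (by fun_prop) (ε / (C + 1)) (by positivity)
  have h1 := abs_integral_sub_eval_sq_le hμ f hp
  have h2 := abs_integral_sub_eval_sq_le hν f hp
  simp only [h'] at h1
  rw [abs_sub_comm] at h2
  calc |∫ x, f x ∂μ - ∫ x, f x ∂ν| ≤ _ + _ := abs_sub_le _ _ _
    _ ≤ ε / (C + 1) * μ.real Set.univ + ε / (C + 1) * ν.real Set.univ := add_le_add h1 h2
    _ = ε * (C / (C + 1)) := by rw [hC]; ring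
    _ ≤ ε * 1 := by
      gcongr
      rw [div_le_one (by positivity)]
      linarith
    _ = ε := mul_one ε

lemma norm_blochImage (r₀ : ℝ) (p : ℝ × ℝ × ℂ × ℂ × ℂ × ℂ × ℂ) :
    ‖blochImage r₀ p‖ = √(((p.2.2.1 + p.2.2.2.2.2.2).re + r₀ * (p.2.2.1 - p.2.2.2.2.2.2).re) ^ 2
      + (-(p.2.2.1 + p.2.2.2.2.2.2).im + r₀ * (p.2.2.2.2.2.2 - p.2.2.1).im) ^ 2
      + (p.1 + p.2.1 - 1 + r₀ * (p.1 - p.2.1)) ^ 2) := by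
  simp [EuclideanSpace.norm_eq, Fin.sum_univ_three, blochImage]

lemma norm_bloch_le {a : ℝ} {b : ℂ} (h : ‖b‖ ^ 2 ≤ a * (1 - a)) :
    ‖(!₂[b.re, -b.im, a - 1 / 2] : EuclideanSpace ℝ (Fin 3))‖ ≤ 1 / 2 := by
  rw [← Complex.normSq_eq_norm_sq, Complex.normSq_apply] at h
  refine abs_le_of_sq_le_sq' ?_ (by norm_num) |>.2
  rw [EuclideanSpace.real_norm_sq_eq, Fin.sum_univ_three]
  simp only [Matrix.cons_val]
  linarith

lemma norm_blochImage_le_one {r₀ : ℝ} (h0 : r₀ ∈ Set.Ioo (0 : ℝ) 1)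
    {p : ℝ × ℝ × ℂ × ℂ × ℂ × ℂ × ℂ} (hp : p ∈ qubitChannelSet) : ‖blochImage r₀ p‖ ≤ 1 := by
  have hb := norm_bloch_le (a := p.1) (b := p.2.2.1)
    (norm_sq_le_of_posSemidef hp.2.2 0 1 (by simp [choiMat]) (by simp [choiMat]))
  have hg := norm_bloch_le (a := p.2.1) (b := p.2.2.2.2.2.2)
    (norm_sq_le_of_posSemidef hp.2.2 2 3 (by simp [choiMat]) (by simp [choiMat]))
  have h : blochImage r₀ p = (1 + r₀) • !₂[p.2.2.1.re, -p.2.2.1.im, p.1 - 1 / 2]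
      + (1 - r₀) • !₂[p.2.2.2.2.2.2.re, -p.2.2.2.2.2.2.im, p.2.1 - 1 / 2] := by
    ext i
    fin_cases i <;> simp [blochImage] <;> ring
  rw [h]
  refine (norm_add_le _ _).trans ?_
  rw [norm_smul_of_nonneg (by linarith [h0.1]), norm_smul_of_nonneg (by linarith [h0.2])]
  nlinarith [h0.1, h0.2]

lemma setLIntegral_norm_blochImage_pow {r₀ : ℝ} (h0 : r₀ ∈ Set.Ioo (0 : ℝ) 1) (k : ℕ) :
    ∫⁻ p in qubitChannelSet, ENNReal.ofReal (‖blochImage r₀ p‖ ^ (2 * k)) =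
      contractionVol * ENNReal.ofReal π * ENNReal.ofReal (1 / 25200) *
        ENNReal.ofReal ((∫ r in (0 : ℝ)..r₀, r ^ (2 * k) * innerDensity r₀ r)
          + ∫ r in r₀..1, r ^ (2 * k) * outerDensity r₀ r) := by
  rw [lintegral_norm_pow_eq (continuous_blochImage r₀).measurable
    fun v => setLIntegral_inner_blochImage v r₀ k]
  have h := setLIntegral_qubitChannelSet
    (φ := fun a f => ENNReal.ofReal ((a + f - 1 + r₀ * (a - f)) ^ (2 * k))) (by fun_prop)
  rw [lintegral_pow_mul_squareDensity_eq h0] at h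
  rw [show ∫⁻ p in qubitChannelSet, ENNReal.ofReal (blochImage r₀ p 2 ^ (2 * k)) = _ from h,
    mul_left_comm, mul_assoc (contractionVol * _),
    ← ENNReal.ofReal_mul (show (0 : ℝ) ≤ 2 * k + 1 by positivity),
    ← ENNReal.ofReal_mul (show (0 : ℝ) ≤ 1 / 25200 by norm_num)]
  congr 2
  field_simp

lemma volume_qubitChannelSet :
    volume qubitChannelSet =
      contractionVol * ENNReal.ofReal π * ENNReal.ofReal (1 / 25200) := by
  have h0 : (1 / 2 : ℝ) ∈ Set.Ioo (0 : ℝ) 1 := by norm_num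
  have h := setLIntegral_norm_blochImage_pow h0 0
  simp only [mul_zero, pow_zero, one_mul, integral_density h0] at h
  simpa using h

lemma volume_qubitChannelSet_ne_zero : volume qubitChannelSet ≠ 0 := by
  rw [volume_qubitChannelSet]
  simp [contractionVol_ne_zero, pi_pos]

lemma volume_qubitChannelSet_ne_top : volume qubitChannelSet ≠ ⊤ := by
  rw [volume_qubitChannelSet]
  exact ENNReal.mul_ne_top (ENNReal.mul_ne_top contractionVol_ne_top ENNReal.ofReal_ne_top)
    ENNReal.ofReal_ne_top

lemma lintegral_norm_blochImage_pow {r₀ : ℝ} (h0 : r₀ ∈ Set.Ioo (0 : ℝ) 1) (k : ℕ) :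
    ∫⁻ p, ENNReal.ofReal (‖blochImage r₀ p‖ ^ (2 * k)) ∂uniformQubitChannel =
      ENNReal.ofReal ((∫ r in (0 : ℝ)..r₀, r ^ (2 * k) * innerDensity r₀ r)
        + ∫ r in r₀..1, r ^ (2 * k) * outerDensity r₀ r) := by
  rw [uniformQubitChannel, lintegral_smul_measure, setLIntegral_norm_blochImage_pow h0,
    ← volume_qubitChannelSet, smul_eq_mul,
    ENNReal.inv_mul_cancel_left volume_qubitChannelSet_ne_zero volume_qubitChannelSet_ne_top]

/-- The density of the Bloch radius of the image of the state with Bloch vector `(0, 0, r₀)`. -/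
noncomputable def radiusDensity (r₀ r : ℝ) : ENNReal :=
  if 0 < r ∧ r ≤ r₀ then ENNReal.ofReal (innerDensity r₀ r)
  else if r₀ < r ∧ r ≤ 1 then ENNReal.ofReal (outerDensity r₀ r)
  else 0

lemma continuous_innerDensity (r₀ : ℝ) : Continuous (innerDensity r₀) := by
  unfold innerDensity
  fun_prop

lemma continuous_outerDensity (r₀ : ℝ) : Continuous (outerDensity r₀) := by
  unfold outerDensity
  fun_prop

lemma measurable_radiusDensity (r₀ : ℝ) : Measurable (radiusDensity r₀) :=
  .ite measurableSet_Ioc (continuous_innerDensity r₀).measurable.ennreal_ofReal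
    (.ite measurableSet_Ioc (continuous_outerDensity r₀).measurable.ennreal_ofReal
      measurable_const)

lemma radiusDensity_eq_zero {r₀ r : ℝ} (h0 : r₀ ∈ Set.Ioo (0 : ℝ) 1) (hr : r ∉ Set.Ioc 0 1) :
    radiusDensity r₀ r = 0 := by
  rw [radiusDensity, if_neg fun h => hr ⟨h.1, h.2.trans h0.2.le⟩,
    if_neg fun h => hr ⟨h0.1.trans h.1, h.2⟩]

lemma lintegral_pow_radiusDensity {r₀ : ℝ} (h0 : r₀ ∈ Set.Ioo (0 : ℝ) 1) (k : ℕ) :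
    ∫⁻ r, ENNReal.ofReal (r ^ (2 * k)) ∂volume.withDensity (radiusDensity r₀) =
      ENNReal.ofReal ((∫ r in (0 : ℝ)..r₀, r ^ (2 * k) * innerDensity r₀ r)
        + ∫ r in r₀..1, r ^ (2 * k) * outerDensity r₀ r) := by
  rw [lintegral_withDensity_eq_lintegral_mul _ (measurable_radiusDensity r₀) (by fun_prop),
    ← setLIntegral_piecewise h0 (by fun_prop) (fun z => (even_two_mul k).pow_nonneg z)
      (continuous_innerDensity r₀) (continuous_outerDensity r₀)
      (fun z => innerDensity_nonneg h0) (fun z => outerDensity_nonneg h0)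
      (D := radiusDensity r₀) fun z hz => ?_,
    ← lintegral_indicator measurableSet_Ioi]
  · refine lintegral_congr fun r => ?_
    by_cases hr : 0 < r
    · rw [Set.indicator_of_mem (Set.mem_Ioi.2 hr), Pi.mul_apply, mul_comm]
    · rw [Set.indicator_of_notMem (mt Set.mem_Ioi.1 hr), Pi.mul_apply,
        radiusDensity_eq_zero h0 fun h => hr h.1, zero_mul]
  · simp only [radiusDensity, hz, true_and]
    split_ifs <;> grind

lemma isProbabilityMeasure_radiusDensity {r₀ : ℝ} (h0 : r₀ ∈ Set.Ioo (0 : ℝ) 1) :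
    IsProbabilityMeasure (volume.withDensity (radiusDensity r₀)) := by
  refine ⟨?_⟩
  simpa [integral_density h0] using lintegral_pow_radiusDensity h0 0

lemma map_norm_blochImage {r₀ : ℝ} (h0 : r₀ ∈ Set.Ioo (0 : ℝ) 1) :
    uniformQubitChannel.map (fun p => ‖blochImage r₀ p‖) =
      volume.withDensity (radiusDensity r₀) := by
  have hY : Measurable fun p => ‖blochImage r₀ p‖ := (continuous_blochImage r₀).norm.measurable
  have := isProbabilityMeasure_radiusDensity h0
  have : IsFiniteMeasure uniformQubitChannel := by
    refine ⟨?_⟩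
    have := lintegral_norm_blochImage_pow h0 0
    simp only [mul_zero, pow_zero, ENNReal.ofReal_one, lintegral_one] at this
    exact this ▸ ENNReal.ofReal_lt_top
  refine ext_of_lintegral_even_pow_eq ?_ ?_ fun k => ?_
  · refine (ae_map_iff hY.aemeasurable measurableSet_Icc).2 ?_
    refine Measure.ae_smul_measure ?_ _
    filter_upwards [ae_restrict_mem isClosed_qubitChannelSet.measurableSet] with p hp
    exact ⟨norm_nonneg _, norm_blochImage_le_one h0 hp⟩
  · rw [ae_withDensity_iff (measurable_radiusDensity r₀)]
    refine .of_forall fun r hr => ?_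
    by_contra h
    exact hr (radiusDensity_eq_zero h0 fun h' => h ⟨h'.1.le, h'.2⟩)
  · rw [lintegral_map (by fun_prop) hY, lintegral_norm_blochImage_pow h0,
      lintegral_pow_radiusDensity h0]

/-- For `r₀ ∈ (0,1)`, the Bloch radius of the image of the state with Bloch vector
`(0,0,r₀)` under a uniformly random qubit channel — the Euclidean norm of
`(Re(b+g) + r₀ Re(b−g), −Im(b+g) + r₀ Im(g−b), a + f − 1 + r₀(a−f))` — has the
displayed piecewise Lebesgue density `κ(r, r₀)`. -/
theorem radius_density_general (r₀ : ℝ) (hr₀ : r₀ ∈ Set.Ioo (0 : ℝ) 1) :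
    Measure.map
        (fun p : ℝ × ℝ × ℂ × ℂ × ℂ × ℂ × ℂ =>
          Real.sqrt
            (((p.2.2.1 + p.2.2.2.2.2.2).re + r₀ * (p.2.2.1 - p.2.2.2.2.2.2).re) ^ 2
              + (-(p.2.2.1 + p.2.2.2.2.2.2).im
                  + r₀ * (p.2.2.2.2.2.2 - p.2.2.1).im) ^ 2
              + (p.1 + p.2.1 - 1 + r₀ * (p.1 - p.2.1)) ^ 2))
        uniformQubitChannel
      = volume.withDensity (fun r : ℝ =>
          if 0 < r ∧ r ≤ r₀ then
            ENNReal.ofReal ((40 * r ^ 2 / (r₀ * (1 + r₀) ^ 6))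
              * (21 * r ^ 4 - 6 * r ^ 2 * r₀ ^ 2 - 36 * r ^ 2 * r₀
                + r₀ ^ 4 + 6 * r₀ ^ 3 + 12 * r₀ ^ 2 + 2 * r₀))
          else if r₀ < r ∧ r ≤ 1 then
            ENNReal.ofReal ((40 * r * (1 - r) ^ 6 / (1 - r₀ ^ 2) ^ 6)
              * (21 * r₀ ^ 4 - 6 * r ^ 2 * r₀ ^ 2 - 36 * r * r₀ ^ 2
                + r ^ 4 + 6 * r ^ 3 + 12 * r ^ 2 + 2 * r))
          else 0) := by
  have h := map_norm_blochImage hr₀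
  simp only [norm_blochImage] at h
  exact h
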